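/- Let d ≥ 3 and v : ℝ^d → ℝ be bounded, measurable, with bounded support. Suppose x(t) → x and y(t) → y in ℝ^d as t → ∞. Let Z(t) = ∫₀^t v(X_s) ds where (X_s, 0 ≤ s ≤ t) is the d-dimensional Brownian bridge from x(t) to y(t) in time t. Let Y_x = ∫₀^∞ v(W_x(s)) ds and Y'_y = ∫₀^∞ v(W'_y(s)) ds with W_x, W'_y independent Brownian motions started at x and y. Then for every integer k ≥ 0, E[(Z(t))^k] → E[(Y_x + Y'_y)^k] as t → ∞. -/

import Mathlib

open MeasureTheory Real Filter Topology ProbabilityTheory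

noncomputable section

/-- Euclidean space `ℝ^d`. -/
abbrev Euc (d : ℕ) := EuclideanSpace ℝ (Fin d)

/-- The Brownian transition density `q(s; w) = (2πs)^{-d/2} exp(-|w|²/(2s))`. -/
def heatKernel (d : ℕ) (s : ℝ) (w : Euc d) : ℝ :=
  (2 * π * s) ^ (-(d : ℝ) / 2) * Real.exp (-‖w‖ ^ 2 / (2 * s))

/-- Joint density of a Brownian motion started at `x`, at times `s 0 < s 1 < ⋯`. -/
def jointDensity (d : ℕ) {k : ℕ} (x : Euc d) (s : Fin k → ℝ) (z : Fin k → Euc d) : ℝ :=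
  ∏ j : Fin k,
    heatKernel d (s j - if (j : ℕ) = 0 then 0 else s ⟨(j : ℕ) - 1, lt_of_le_of_lt (Nat.sub_le _ _) j.isLt⟩)
      (z j - if (j : ℕ) = 0 then x else z ⟨(j : ℕ) - 1, lt_of_le_of_lt (Nat.sub_le _ _) j.isLt⟩)

/-- Joint density of the Brownian bridge from `a` to `b` in time `t`, at interior times `s`. -/
def bridgeDensity (d : ℕ) {k : ℕ} (t : ℝ) (a b : Euc d) (s : Fin k → ℝ) (z : Fin k → Euc d) : ℝ :=
  jointDensity d a (Fin.snoc s t) (Fin.snoc z b) / heatKernel d t (b - a)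

/-- The open ordered simplex `0 < s₁ < ⋯ < s_k < t`. -/
def simplex (k : ℕ) (t : ℝ) : Set (Fin k → ℝ) :=
  {s | StrictMono s ∧ ∀ i, 0 < s i ∧ s i < t}

/-- `W` is a standard `d`-dimensional Brownian motion started at `x`, characterized by
continuous paths and finite-dimensional densities given by products of heat kernels. -/
def IsBrownianMotion {Ω : Type*} [MeasureSpace Ω] {d : ℕ} (x : Euc d)
    (W : ℝ → Ω → Euc d) : Prop :=
  (∀ ω, W 0 ω = x) ∧ (∀ ω, Continuous fun s => W s ω) ∧
  ∀ (k : ℕ) (s : Fin (k + 1) → ℝ), StrictMono s → (∀ i, 0 < s i) →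
    Measure.map (fun ω (i : Fin (k + 1)) => W (s i) ω) (ℙ : Measure Ω) =
      (volume : Measure (Fin (k + 1) → Euc d)).withDensity
        (fun z => ENNReal.ofReal (jointDensity d x s z))

/-- `X` is a `d`-dimensional Brownian bridge from `a` to `b` in time `t`. -/
def IsBrownianBridge {Ω : Type*} [MeasureSpace Ω] {d : ℕ} (t : ℝ) (a b : Euc d)
    (X : ℝ → Ω → Euc d) : Prop :=
  (∀ ω, X 0 ω = a) ∧ (∀ ω, X t ω = b) ∧
  (∀ ω, ContinuousOn (fun s => X s ω) (Set.Icc 0 t)) ∧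
  ∀ (k : ℕ) (s : Fin (k + 1) → ℝ), StrictMono s → (∀ i, 0 < s i ∧ s i < t) →
    Measure.map (fun ω (i : Fin (k + 1)) => X (s i) ω) (ℙ : Measure Ω) =
      (volume : Measure (Fin (k + 1) → Euc d)).withDensity
        (fun z => ENNReal.ofReal (bridgeDensity d t a b s z))

/-- The path integral `∫₀^t v(X_s) ds`. -/
def pathInt {Ω : Type*} {d : ℕ} (v : Euc d → ℝ) (X : ℝ → Ω → Euc d) (t : ℝ) (ω : Ω) : ℝ :=
  ∫ s in Set.Ioc (0 : ℝ) t, v (X s ω)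

/-- The total path integral `∫₀^∞ v(X_s) ds`. -/
def pathIntInf {Ω : Type*} {d : ℕ} (v : Euc d → ℝ) (X : ℝ → Ω → Euc d) (ω : Ω) : ℝ :=
  ∫ s in Set.Ioi (0 : ℝ), v (X s ω)

/-- The density ratio `Q_{j} = q(t; y - x)/q(Δ_j s; Δ_j z)` with the conventions
`s₀ = 0`, `s_{k+1} = t`, `z₀ = x`, `z_{k+1} = y`. -/
def Qratio (d : ℕ) {k : ℕ} (t : ℝ) (x y : Euc d) (s : Fin k → ℝ) (z : Fin k → Euc d)
    (j : Fin (k + 1)) : ℝ :=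
  heatKernel d t (y - x) /
    heatKernel d
      ((Fin.cons 0 (Fin.snoc s t) : Fin (k + 2) → ℝ) j.succ -
        (Fin.cons 0 (Fin.snoc s t) : Fin (k + 2) → ℝ) j.castSucc)
      ((Fin.cons x (Fin.snoc z y) : Fin (k + 2) → Euc d) j.succ -
        (Fin.cons x (Fin.snoc z y) : Fin (k + 2) → Euc d) j.castSucc)

lemma heatKernel_pos {d : ℕ} {s : ℝ} (hs : 0 < s) (w : Euc d) : 0 < heatKernel d s w := by
  unfold heatKernel; positivity

lemma heatKernel_sub_comm (d : ℕ) (s : ℝ) (w w' : Euc d) :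
    heatKernel d s (w - w') = heatKernel d s (w' - w) := by
  simp only [heatKernel, norm_sub_rev]

lemma heatKernel_le {d : ℕ} {s : ℝ} (hs : 0 < s) (w : Euc d) :
    heatKernel d s w ≤ (2 * π * s) ^ (-(d : ℝ) / 2) := by
  unfold heatKernel
  refine mul_le_of_le_one_right (by positivity) (Real.exp_le_one_iff.2 ?_)
  rw [neg_div]
  exact neg_nonpos.2 (by positivity)

lemma continuous_heatKernel (d : ℕ) (s : ℝ) : Continuous (heatKernel d s) := by
  unfold heatKernel; fun_prop

/-- The transition density of a Brownian bridge is bounded by a function of the gaps. -/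
lemma heatKernel_mul_div_le {d : ℕ} {α β : ℝ} (hα : 0 < α) (hβ : 0 < β) (w w' : Euc d) :
    heatKernel d α w * heatKernel d β w' / heatKernel d (α + β) (w + w') ≤
      (π * α) ^ (-(d : ℝ) / 2) + (π * β) ^ (-(d : ℝ) / 2) := by
  have key : ∀ {α β : ℝ} (_ : 0 < α) (_ : 0 < β) (_ : α ≤ β) (w w' : Euc d),
      heatKernel d α w * heatKernel d β w' / heatKernel d (α + β) (w + w') ≤
        (π * α) ^ (-(d : ℝ) / 2) := by
    intro α β hα hβ hαβ w w'
    rw [div_le_iff₀ (heatKernel_pos (by positivity) _)]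
    unfold heatKernel
    have hp : -(d : ℝ) / 2 ≤ 0 := by rw [neg_div]; exact neg_nonpos.2 (by positivity)
    have h1 : (2 * π * α) ^ (-(d : ℝ) / 2) * (2 * π * β) ^ (-(d : ℝ) / 2) ≤
        (π * α) ^ (-(d : ℝ) / 2) * (2 * π * (α + β)) ^ (-(d : ℝ) / 2) := by
      rw [← Real.mul_rpow (by positivity) (by positivity),
        ← Real.mul_rpow (by positivity) (by positivity)]
      refine Real.rpow_le_rpow_of_nonpos (by positivity) ?_ hp
      nlinarith [mul_pos hα hβ, mul_nonneg hα.le (sub_nonneg.2 hαβ), sq_nonneg π,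
        mul_nonneg (sq_nonneg π) (mul_nonneg hα.le (sub_nonneg.2 hαβ))]
    have h2 : -‖w‖ ^ 2 / (2 * α) + -‖w'‖ ^ 2 / (2 * β) ≤ -‖w + w'‖ ^ 2 / (2 * (α + β)) := by
      have h3 : ‖w + w'‖ ^ 2 / (α + β) ≤ ‖w‖ ^ 2 / α + ‖w'‖ ^ 2 / β := by
        have h4 : ‖w + w'‖ ^ 2 ≤ (‖w‖ + ‖w'‖) ^ 2 := by
          gcongr; exact norm_add_le _ _
        rw [div_add_div _ _ hα.ne' hβ.ne', div_le_div_iff₀ (by positivity) (by positivity)]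
        nlinarith [mul_le_mul_of_nonneg_right h4 (mul_pos hα hβ).le,
          sq_nonneg (β * ‖w‖ - α * ‖w'‖)]
      have e1 : -‖w‖ ^ 2 / (2 * α) = -(‖w‖ ^ 2 / α) / 2 := by field_simp
      have e2 : -‖w'‖ ^ 2 / (2 * β) = -(‖w'‖ ^ 2 / β) / 2 := by field_simp
      have e3 : -‖w + w'‖ ^ 2 / (2 * (α + β)) = -(‖w + w'‖ ^ 2 / (α + β)) / 2 := by field_simp
      rw [e1, e2, e3]; linarith
    have h5 := Real.exp_le_exp.2 h2
    rw [Real.exp_add] at h5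
    calc _ = ((2 * π * α) ^ (-(d : ℝ) / 2) * (2 * π * β) ^ (-(d : ℝ) / 2)) *
          (Real.exp (-‖w‖ ^ 2 / (2 * α)) * Real.exp (-‖w'‖ ^ 2 / (2 * β))) := by ring
      _ ≤ ((π * α) ^ (-(d : ℝ) / 2) * (2 * π * (α + β)) ^ (-(d : ℝ) / 2)) *
          Real.exp (-‖w + w'‖ ^ 2 / (2 * (α + β))) := by gcongr
      _ = _ := by ring
  rcases le_total α β with h | h
  · exact (key hα hβ h w w').trans (le_add_of_nonneg_right (by positivity))
  · have := key hβ hα h w' w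
    rw [mul_comm, add_comm β α, add_comm w' w] at this
    exact this.trans (le_add_of_nonneg_left (by positivity))

lemma jointDensity_eq_prod_cons {d k : ℕ} (x : Euc d) (s : Fin k → ℝ) (z : Fin k → Euc d) :
    jointDensity d x s z = ∏ j : Fin k,
      heatKernel d (s j - (Fin.cons 0 s : Fin (k + 1) → ℝ) j.castSucc)
        (z j - (Fin.cons x z : Fin (k + 1) → Euc d) j.castSucc) := by
  unfold jointDensity
  refine Finset.prod_congr rfl fun j _ => ?_
  have key : ∀ {α : Type} (a : α) (f : Fin k → α),
      (Fin.cons a f : Fin (k + 1) → α) j.castSucc = if (j : ℕ) = 0 then a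
        else f ⟨(j : ℕ) - 1, lt_of_le_of_lt (Nat.sub_le _ _) j.isLt⟩ := by
    intro α a f
    split_ifs with h
    · have : j.castSucc = 0 := Fin.ext h
      rw [this, Fin.cons_zero]
    · have : j.castSucc = Fin.succ ⟨(j : ℕ) - 1, lt_of_le_of_lt (Nat.sub_le _ _) j.isLt⟩ := by
        ext; simp; omega
      rw [this, Fin.cons_succ]
  rw [key, key]

lemma jointDensity_snoc {d k : ℕ} (x : Euc d) (s : Fin k → ℝ) (z : Fin k → Euc d)
    (u : ℝ) (w : Euc d) :
    jointDensity d x (Fin.snoc s u) (Fin.snoc z w) = jointDensity d x s z *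
      heatKernel d (u - (Fin.cons 0 s : Fin (k + 1) → ℝ) (Fin.last k))
        (w - (Fin.cons x z : Fin (k + 1) → Euc d) (Fin.last k)) := by
  simp only [jointDensity_eq_prod_cons, Fin.prod_univ_castSucc, Fin.cons_snoc_eq_snoc_cons,
    Fin.snoc_castSucc, Fin.snoc_last]

lemma jointDensity_zero {d : ℕ} (x : Euc d) (s : Fin 0 → ℝ) (z : Fin 0 → Euc d) :
    jointDensity d x s z = 1 := by
  simp [jointDensity]

lemma continuous_jointDensity (d : ℕ) {k : ℕ} (s : Fin k → ℝ) :
    Continuous fun p : Euc d × (Fin k → Euc d) => jointDensity d p.1 s p.2 := by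
  unfold jointDensity
  refine continuous_finsetProd _ fun j _ => (continuous_heatKernel _ _).comp ?_
  split_ifs <;> fun_prop

/-- Positivity of the increments of an increasing positive sequence, including the first one. -/
lemma sub_cons_castSucc_pos {k : ℕ} {s : Fin k → ℝ} (hs : StrictMono s) (h0 : ∀ i, 0 < s i)
    (j : Fin k) : 0 < s j - (Fin.cons 0 s : Fin (k + 1) → ℝ) j.castSucc := by
  obtain ⟨j, hj⟩ := j
  cases j with
  | zero => simpa using h0 _
  | succ j =>
    have : (Fin.castSucc ⟨j + 1, hj⟩ : Fin (k + 1)) = Fin.succ ⟨j, by omega⟩ := rfl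
    rw [this, Fin.cons_succ, sub_pos]
    exact hs (by simp [Fin.lt_def])

lemma jointDensity_pos {d k : ℕ} {s : Fin k → ℝ} (hs : StrictMono s) (h0 : ∀ i, 0 < s i)
    (x : Euc d) (z : Fin k → Euc d) : 0 < jointDensity d x s z := by
  rw [jointDensity_eq_prod_cons]
  exact Finset.prod_pos fun j _ => heatKernel_pos (sub_cons_castSucc_pos hs h0 j) _

lemma exists_jointDensity_le (d : ℕ) {k : ℕ} {s : Fin k → ℝ} (hs : StrictMono s)
    (h0 : ∀ i, 0 < s i) : ∃ C, ∀ (x : Euc d) (z : Fin k → Euc d), jointDensity d x s z ≤ C := by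
  refine ⟨∏ j : Fin k, (2 * π * (s j - (Fin.cons 0 s : Fin (k + 1) → ℝ) j.castSucc)) ^
    (-(d : ℝ) / 2), fun x z => ?_⟩
  rw [jointDensity_eq_prod_cons]
  exact Finset.prod_le_prod
    (fun j _ => (heatKernel_pos (sub_cons_castSucc_pos hs h0 j) _).le)
    (fun j _ => heatKernel_le (sub_cons_castSucc_pos hs h0 j) _)

lemma jointDensity_snoc_comp_cast {d m n : ℕ} (h : m = n) (x y : Euc d) (t : ℝ) (s : Fin n → ℝ)
    (z : Fin n → Euc d) :
    jointDensity d x (Fin.snoc (s ∘ Fin.cast h) t) (Fin.snoc (z ∘ Fin.cast h) y) =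
      jointDensity d x (Fin.snoc s t) (Fin.snoc z y) := by
  subst h; rfl

lemma comp_rev_eq_cons {α β : Type*} {n : ℕ} (f : α → β) (r : Fin (n + 1) → α) :
    (fun i => f (r (Fin.rev i))) =
      Fin.cons (f (r (Fin.last n))) (fun i => f (Fin.init r (Fin.rev i))) := by
  funext i
  refine Fin.cases ?_ (fun i => ?_) i
  · simp
  · simp [Fin.init, Fin.rev_succ]

/-- The heat kernel product along a path from `a` to `b` splits into a product started at `a`,
a product started at `b` (in reversed time), and the factor of the gap between the two. -/
lemma jointDensity_snoc_append_rev {d n : ℕ} (a b : Euc d) (t : ℝ) (r : Fin n → ℝ)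
    (w : Fin n → Euc d) : ∀ {m : ℕ} (s : Fin m → ℝ) (z : Fin m → Euc d),
    jointDensity d a (Fin.snoc (Fin.append s fun i => t - r (Fin.rev i)) t)
        (Fin.snoc (Fin.append z fun i => w (Fin.rev i)) b) =
      jointDensity d a s z *
        heatKernel d (t - (Fin.cons 0 r : Fin (n + 1) → ℝ) (Fin.last n) -
            (Fin.cons 0 s : Fin (m + 1) → ℝ) (Fin.last m))
          ((Fin.cons b w : Fin (n + 1) → Euc d) (Fin.last n) -
            (Fin.cons a z : Fin (m + 1) → Euc d) (Fin.last m)) *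
        jointDensity d b r w := by
  induction n with
  | zero =>
    intro m s z
    rw [jointDensity_zero b r w, Fin.append_right_nil _ _ rfl, Fin.append_right_nil _ _ rfl,
      jointDensity_snoc_comp_cast, jointDensity_snoc]
    simp
  | succ n ih =>
    intro m s z
    have hw := comp_rev_eq_cons id w
    simp only [id] at hw
    rw [comp_rev_eq_cons (fun q => t - q) r, hw, Fin.append_right_cons, Fin.append_right_cons,
      jointDensity_snoc_comp_cast, ih]
    conv_rhs => rw [← Fin.snoc_init_self r, ← Fin.snoc_init_self w]
    rw [jointDensity_snoc, jointDensity_snoc, Fin.cons_snoc_eq_snoc_cons,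
      Fin.cons_snoc_eq_snoc_cons, Fin.cons_snoc_eq_snoc_cons, Fin.cons_snoc_eq_snoc_cons]
    simp only [Fin.snoc_last]
    rw [heatKernel_sub_comm d _ ((Fin.cons b (Fin.init w) : Fin (n + 1) → Euc d) (Fin.last n))]
    have e : t - (Fin.cons 0 (Fin.init r) : Fin (n + 1) → ℝ) (Fin.last n) -
        (t - r (Fin.last n)) =
        r (Fin.last n) - (Fin.cons 0 (Fin.init r) : Fin (n + 1) → ℝ) (Fin.last n) := by ring
    rw [e]
    ring

/-- For every increasing sequence of times in `A`, the vector of values of `X` at these times has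
the density given by `p`. -/
def HasDensities {Ω : Type*} [MeasurableSpace Ω] {d : ℕ} (P : Measure Ω) (X : ℝ → Ω → Euc d)
    (A : Set ℝ) (p : ∀ k : ℕ, (Fin k → ℝ) → (Fin k → Euc d) → ℝ) : Prop :=
  ∀ (k : ℕ) (s : Fin k → ℝ), StrictMono s → (∀ i, s i ∈ A) →
    Measure.map (fun ω (i : Fin k) => X (s i) ω) P =
      (volume : Measure (Fin k → Euc d)).withDensity fun z => ENNReal.ofReal (p k s z)

/-- It suffices to check `HasDensities` for nonempty sequences of times. -/
lemma HasDensities.of_succ {Ω : Type*} [MeasurableSpace Ω] {d : ℕ} {P : Measure Ω}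
    [IsProbabilityMeasure P] {X : ℝ → Ω → Euc d} {A : Set ℝ}
    {p : ∀ k : ℕ, (Fin k → ℝ) → (Fin k → Euc d) → ℝ} (h0 : ∀ s z, p 0 s z = 1)
    (h : ∀ (k : ℕ) (s : Fin (k + 1) → ℝ), StrictMono s → (∀ i, s i ∈ A) →
      Measure.map (fun ω (i : Fin (k + 1)) => X (s i) ω) P =
        (volume : Measure (Fin (k + 1) → Euc d)).withDensity
          fun z => ENNReal.ofReal (p (k + 1) s z)) :
    HasDensities P X A p := by
  intro k
  cases k with
  | succ k => exact h k
  | zero =>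
    intro s _ _
    have e : (fun ω (i : Fin 0) => X (s i) ω) = fun _ => isEmptyElim := by
      funext ω i; exact i.elim0
    rw [e, Measure.map_const, measure_univ, one_smul, Measure.volume_pi_eq_dirac]
    simp only [h0, ENNReal.ofReal_one]
    rw [show (fun _ : Fin 0 → Euc d => (1 : ENNReal)) = 1 from rfl, withDensity_one]

lemma HasDensities.lintegral_comp {Ω : Type*} [MeasurableSpace Ω] {d : ℕ} {P : Measure Ω}
    {X : ℝ → Ω → Euc d} {A : Set ℝ} {p : ∀ k : ℕ, (Fin k → ℝ) → (Fin k → Euc d) → ℝ}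
    (h : HasDensities P X A p) (hX : ∀ s, Measurable (X s)) {k : ℕ} {s : Fin k → ℝ}
    (hs : StrictMono s) (hsA : ∀ i, s i ∈ A) (hp : Measurable (p k s))
    {Φ : (Fin k → Euc d) → ENNReal} (hΦ : Measurable Φ) :
    ∫⁻ ω, Φ (fun i => X (s i) ω) ∂P = ∫⁻ z, ENNReal.ofReal (p k s z) * Φ z := by
  rw [← lintegral_map hΦ (measurable_pi_lambda _ fun i => hX (s i)), h k s hs hsA,
    lintegral_withDensity_eq_lintegral_mul _ hp.ennreal_ofReal hΦ]
  rfl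

lemma HasDensities.integral_comp {Ω : Type*} [MeasurableSpace Ω] {d : ℕ} {P : Measure Ω}
    {X : ℝ → Ω → Euc d} {A : Set ℝ} {p : ∀ k : ℕ, (Fin k → ℝ) → (Fin k → Euc d) → ℝ}
    (h : HasDensities P X A p) (hX : ∀ s, Measurable (X s)) {k : ℕ} {s : Fin k → ℝ}
    (hs : StrictMono s) (hsA : ∀ i, s i ∈ A) (hp : Measurable (p k s)) (hp0 : ∀ z, 0 ≤ p k s z)
    {Φ : (Fin k → Euc d) → ℝ} (hΦ : Measurable Φ) :
    ∫ ω, Φ (fun i => X (s i) ω) ∂P = ∫ z, p k s z * Φ z := by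
  rw [← integral_map (measurable_pi_lambda _ fun i => hX (s i)).aemeasurable
      hΦ.aestronglyMeasurable, h k s hs hsA,
    integral_withDensity_eq_integral_toReal_smul hp.ennreal_ofReal (by simp)]
  simp only [ENNReal.toReal_ofReal (hp0 _), smul_eq_mul]

lemma measurable_jointDensity (d : ℕ) {k : ℕ} (x : Euc d) (s : Fin k → ℝ) :
    Measurable (jointDensity d x s) :=
  ((continuous_jointDensity d s).comp (Continuous.prodMk_right x)).measurable

lemma continuous_snoc {α : Type*} [TopologicalSpace α] {k : ℕ} :
    Continuous fun p : (Fin k → α) × α => (Fin.snoc p.1 p.2 : Fin (k + 1) → α) := by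
  refine continuous_pi fun i => ?_
  refine Fin.lastCases ?_ (fun i => ?_) i
  · simpa using continuous_snd
  · simp only [Fin.snoc_castSucc]; fun_prop

lemma continuous_bridgeDensity (d : ℕ) {k : ℕ} (t : ℝ) (a b : Euc d) (s : Fin k → ℝ) :
    Continuous (bridgeDensity d t a b s) := by
  unfold bridgeDensity
  have h : Continuous fun z : Fin k → Euc d => (a, (Fin.snoc z b : Fin (k + 1) → Euc d)) :=
    continuous_const.prodMk (continuous_snoc.comp (continuous_id.prodMk continuous_const))
  exact ((continuous_jointDensity d (Fin.snoc s t)).comp h).div_const _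

lemma strictMono_snoc {k : ℕ} {s : Fin k → ℝ} {t : ℝ} (hs : StrictMono s) (ht : ∀ i, s i < t) :
    StrictMono (Fin.snoc s t : Fin (k + 1) → ℝ) := by
  intro i j
  refine Fin.lastCases ?_ (fun j => ?_) j
  · refine Fin.lastCases (fun h => absurd h (lt_irrefl _)) (fun i _ => ?_) i
    simpa using ht i
  · refine Fin.lastCases (fun h => absurd h (not_lt.2 (Fin.le_last _))) (fun i h => ?_) i
    simpa using hs (Fin.castSucc_lt_castSucc_iff.1 h)

lemma snoc_pos {k : ℕ} {s : Fin k → ℝ} {t : ℝ} (hs : ∀ i, 0 < s i) (ht : 0 < t)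
    (i : Fin (k + 1)) : 0 < (Fin.snoc s t : Fin (k + 1) → ℝ) i := by
  refine Fin.lastCases ?_ (fun i => ?_) i
  · simpa using ht
  · simpa using hs i

lemma bridgeDensity_nonneg {d k : ℕ} {t : ℝ} (ht : 0 < t) (a b : Euc d) {s : Fin k → ℝ}
    (hs : StrictMono s) (hst : ∀ i, 0 < s i ∧ s i < t) (z : Fin k → Euc d) :
    0 ≤ bridgeDensity d t a b s z :=
  div_nonneg (jointDensity_pos (strictMono_snoc hs fun i => (hst i).2)
    (snoc_pos (fun i => (hst i).1) ht) _ _).le (heatKernel_pos ht _).le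

lemma tendsto_heatKernel_div {d : ℕ} (c : ℝ) {w u : ℝ → Euc d} {w₀ u₀ : Euc d}
    (hw : Tendsto w atTop (𝓝 w₀)) (hu : Tendsto u atTop (𝓝 u₀)) :
    Tendsto (fun t => heatKernel d (t - c) (w t) / heatKernel d t (u t)) atTop (𝓝 1) := by
  have h1 : Tendsto (fun t : ℝ => (1 - c / t) ^ (-(d : ℝ) / 2)) atTop (𝓝 1) := by
    have : Tendsto (fun t : ℝ => 1 - c / t) atTop (𝓝 (1 - 0)) :=
      tendsto_const_nhds.sub (tendsto_const_nhds.div_atTop tendsto_id)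
    rw [sub_zero] at this
    simpa using this.rpow_const (p := -(d : ℝ) / 2) (Or.inl one_ne_zero)
  have h2 : Tendsto (fun t : ℝ => Real.exp (-‖w t‖ ^ 2 / (2 * (t - c)) - -‖u t‖ ^ 2 / (2 * t)))
      atTop (𝓝 1) := by
    rw [← Real.exp_zero, ← sub_zero (0 : ℝ)]
    refine (Real.continuous_exp.tendsto _).comp (Tendsto.sub ?_ ?_)
    · exact (hw.norm.pow 2).neg.div_atTop
        ((tendsto_atTop_add_const_right _ (-c) tendsto_id).const_mul_atTop (by norm_num))
    · exact (hu.norm.pow 2).neg.div_atTop (tendsto_id.const_mul_atTop (by norm_num))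
  have h3 := h1.mul h2
  rw [one_mul] at h3
  refine h3.congr' ?_
  filter_upwards [eventually_gt_atTop 0, eventually_gt_atTop c] with t ht htc
  unfold heatKernel
  have e : 1 - c / t = (2 * π * (t - c)) / (2 * π * t) := by field_simp
  rw [e, Real.div_rpow (by have := sub_pos.2 htc; positivity) (by positivity), Real.exp_sub,
    mul_div_mul_comm]

/-- Concatenation of two tuples, the second one reversed. -/
def appendRevEquiv (α : Type*) [MeasurableSpace α] (m n : ℕ) :
    (Fin m → α) × (Fin n → α) ≃ᵐ (Fin (m + n) → α) :=
  (MeasurableEquiv.sumPiEquivProdPi fun _ : Fin m ⊕ Fin n => α).symm.trans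
    (MeasurableEquiv.piCongrLeft (fun _ => α)
      ((Equiv.sumCongr (Equiv.refl _) Fin.revPerm).trans finSumFinEquiv))

lemma appendRevEquiv_apply {α : Type*} [MeasurableSpace α] {m n : ℕ} (z : Fin m → α)
    (w : Fin n → α) :
    appendRevEquiv α m n (z, w) = Fin.append z fun i => w (Fin.rev i) := by
  funext i
  refine Fin.addCases (fun i => ?_) (fun i => ?_) i
  · rw [Fin.append_left]
    have := MeasurableEquiv.piCongrLeft_apply_apply
      ((Equiv.sumCongr (Equiv.refl (Fin m)) (Fin.revPerm (n := n))).trans finSumFinEquiv)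
      (β := fun _ => α)
      ((MeasurableEquiv.sumPiEquivProdPi fun _ : Fin m ⊕ Fin n => α).symm (z, w)) (Sum.inl i)
    simp at this
    exact this
  · rw [Fin.append_right]
    have := MeasurableEquiv.piCongrLeft_apply_apply
      ((Equiv.sumCongr (Equiv.refl (Fin m)) (Fin.revPerm (n := n))).trans finSumFinEquiv)
      (β := fun _ => α)
      ((MeasurableEquiv.sumPiEquivProdPi fun _ : Fin m ⊕ Fin n => α).symm (z, w))
      (Sum.inr i.rev)
    simp at this
    exact this

lemma measurePreserving_appendRevEquiv (α : Type*) [MeasureSpace α]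
    [SigmaFinite (volume : Measure α)] (m n : ℕ) :
    MeasurePreserving (appendRevEquiv α m n) :=
  (volume_measurePreserving_sumPiEquivProdPi_symm fun _ : Fin m ⊕ Fin n => α).trans
    (volume_measurePreserving_piCongrLeft (fun _ => α) _)

lemma strictMono_append_rev {m n : ℕ} {s : Fin m → ℝ} {r : Fin n → ℝ} {t : ℝ}
    (hs : StrictMono s) (hr : StrictMono r) (h : ∀ i j, s i < t - r j) :
    StrictMono (Fin.append s fun i => t - r (Fin.rev i)) := by
  intro i j
  refine Fin.addCases (fun i => ?_) (fun i => ?_) i <;>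
    refine Fin.addCases (fun j => ?_) (fun j => ?_) j <;> intro hij
  · simpa using hs (Fin.lt_def.2 (Fin.lt_def.1 hij))
  · simpa using h i _
  · exact absurd hij (by simp [Fin.lt_def]; omega)
  · simpa using hr (by simpa using hij)

lemma integrable_of_bounded_support {d : ℕ} {v : Euc d → ℝ} (hvm : Measurable v)
    (hvb : ∃ C : ℝ, ∀ z, |v z| ≤ C) (hvs : ∃ R : ℝ, ∀ z, v z ≠ 0 → ‖z‖ ≤ R) : Integrable v := by
  obtain ⟨C, hC⟩ := hvb
  obtain ⟨R, hR⟩ := hvs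
  have hsupp : Function.support v ⊆ Metric.closedBall 0 R := fun z hz => by
    simpa using hR z hz
  rw [← integrableOn_iff_integrable_of_support_subset hsupp]
  exact Measure.integrableOn_of_bounded measure_closedBall_lt_top.ne hvm.aestronglyMeasurable
    (ae_of_all _ fun z => by simpa using hC z)

lemma exists_jointDensity_mem_Icc {d : ℕ} {k : ℕ} {s : Fin k → ℝ} (hs : StrictMono s)
    (h0 : ∀ i, 0 < s i) : ∃ C, 0 ≤ C ∧ ∀ (x : Euc d) (z : Fin k → Euc d),
      0 ≤ jointDensity d x s z ∧ jointDensity d x s z ≤ C := by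
  obtain ⟨C, hC⟩ := exists_jointDensity_le d hs h0
  exact ⟨C, (jointDensity_pos hs h0 0 0).le.trans (hC 0 0), fun x z =>
    ⟨(jointDensity_pos hs h0 x z).le, hC x z⟩⟩

/-- Convergence of the correlations of a bridge near its two endpoints, at increasing times. -/
lemma tendsto_integral_prod_of_strictMono {d : ℕ} {v : Euc d → ℝ} (hvm : Measurable v)
    (hvb : ∃ C : ℝ, ∀ z, |v z| ≤ C) (hvs : ∃ R : ℝ, ∀ z, v z ≠ 0 → ‖z‖ ≤ R)
    {xf yf : ℝ → Euc d} {x y : Euc d} (hx : Tendsto xf atTop (𝓝 x)) (hy : Tendsto yf atTop (𝓝 y))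
    {Ω : Type*} [MeasurableSpace Ω] {P : Measure Ω} {X : ℝ → ℝ → Ω → Euc d}
    (hXm : ∀ t s, Measurable (X t s))
    (hX : ∀ t, 0 < t → HasDensities P (X t) (Set.Ioo 0 t)
      fun _ => bridgeDensity d t (xf t) (yf t))
    {Ω' : Type*} [MeasurableSpace Ω'] {P' : Measure Ω'} {W W' : ℝ → Ω' → Euc d}
    (hWm : ∀ s, Measurable (W s)) (hWm' : ∀ s, Measurable (W' s))
    (hW : HasDensities P' W (Set.Ioi 0) fun _ => jointDensity d x)
    (hW' : HasDensities P' W' (Set.Ioi 0) fun _ => jointDensity d y)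
    {m n : ℕ} {s : Fin m → ℝ} {r : Fin n → ℝ} (hs : StrictMono s) (hr : StrictMono r)
    (hs0 : ∀ i, 0 < s i) (hr0 : ∀ i, 0 < r i) :
    Tendsto (fun t => ∫ ω, (∏ i, v (X t (s i) ω)) * ∏ j, v (X t (t - r j) ω) ∂P) atTop
      (𝓝 ((∫ ω, ∏ i, v (W (s i) ω) ∂P') * ∫ ω, ∏ j, v (W' (r j) ω) ∂P')) := by
  have hprodm : ∀ k : ℕ, Measurable fun z : Fin k → Euc d => ∏ i, v (z i) := fun k =>
    Finset.measurable_prod _ fun i _ => hvm.comp (measurable_pi_apply i)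
  obtain ⟨Cs, hCs0, hCs⟩ := exists_jointDensity_mem_Icc (d := d) hs hs0
  obtain ⟨Cr, hCr0, hCr⟩ := exists_jointDensity_mem_Icc (d := d) hr hr0
  have hv := integrable_of_bounded_support hvm hvb hvs
  -- the limit as one integral
  rw [hW.integral_comp (Φ := fun z => ∏ i, v (z i)) hWm hs hs0 (measurable_jointDensity d x s)
      (fun z => (hCs x z).1) (hprodm m),
    hW'.integral_comp (Φ := fun z => ∏ i, v (z i)) hWm' hr hr0 (measurable_jointDensity d y r)
      (fun z => (hCr y z).1) (hprodm n),
    ← integral_prod_mul]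
  set cs := (Fin.cons 0 s : Fin (m + 1) → ℝ) (Fin.last m) with hcs
  set cr := (Fin.cons 0 r : Fin (n + 1) → ℝ) (Fin.last n) with hcr
  let w : (Fin m → Euc d) × (Fin n → Euc d) → ℝ → Euc d := fun p t =>
    (Fin.cons (yf t) p.2 : Fin (n + 1) → Euc d) (Fin.last n) -
      (Fin.cons (xf t) p.1 : Fin (m + 1) → Euc d) (Fin.last m)
  let F : ℝ → (Fin m → Euc d) × (Fin n → Euc d) → ℝ := fun t p =>
    jointDensity d (xf t) s p.1 *
      (heatKernel d (t - (cr + cs)) (w p t) / heatKernel d t (yf t - xf t)) *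
      jointDensity d (yf t) r p.2 * ((∏ i, v (p.1 i)) * ∏ j, v (p.2 j))
  have hyx : Tendsto (fun t => yf t - xf t) atTop (𝓝 (y - x)) := hy.sub hx
  have hw : ∀ p, ∃ w₀, Tendsto (w p) atTop (𝓝 w₀) := by
    intro p
    have h1 : ∀ {k : ℕ} (q : Fin k → Euc d) {f : ℝ → Euc d} {a : Euc d}
        (_ : Tendsto f atTop (𝓝 a)), Tendsto
          (fun t => (Fin.cons (f t) q : Fin (k + 1) → Euc d) (Fin.last k)) atTop
          (𝓝 ((Fin.cons a q : Fin (k + 1) → Euc d) (Fin.last k))) := by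
      intro k q f a hf
      refine Fin.cases (motive := fun i => Tendsto
        (fun t => (Fin.cons (f t) q : Fin (k + 1) → Euc d) i) atTop
          (𝓝 ((Fin.cons a q : Fin (k + 1) → Euc d) i))) ?_ (fun i => ?_) (Fin.last k)
      · simpa using hf
      · simp
    exact ⟨_, (h1 p.2 hy).sub (h1 p.1 hx)⟩
  have hdom : Tendsto (fun t => ∫ p, F t p) atTop (𝓝 (∫ p : (Fin m → Euc d) × (Fin n → Euc d),
      (jointDensity d x s p.1 * ∏ i, v (p.1 i)) * (jointDensity d y r p.2 * ∏ i, v (p.2 i)))) := by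
    refine tendsto_integral_filter_of_dominated_convergence
      (fun p => Cs * 2 * Cr * ‖(∏ i, v (p.1 i)) * ∏ j, v (p.2 j)‖) ?_ ?_ ?_ ?_
    · refine Eventually.of_forall fun t => Measurable.aestronglyMeasurable ?_
      have hlast : ∀ {k : ℕ} (a : Euc d), Measurable fun q : Fin k → Euc d =>
          (Fin.cons a q : Fin (k + 1) → Euc d) (Fin.last k) := by
        intro k a
        refine Fin.cases (motive := fun i => Measurable fun q : Fin k → Euc d =>
          (Fin.cons a q : Fin (k + 1) → Euc d) i) ?_ (fun i => ?_) (Fin.last k)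
        · simp
        · simpa using measurable_pi_apply i
      refine ((((measurable_jointDensity d _ s).comp measurable_fst).mul
        (((continuous_heatKernel d _).measurable.comp ?_).div_const _)).mul
        ((measurable_jointDensity d _ r).comp measurable_snd)).mul
        (((hprodm m).comp measurable_fst).mul ((hprodm n).comp measurable_snd))
      exact ((hlast _).comp measurable_snd).sub ((hlast _).comp measurable_fst)
    · have h1 := tendsto_heatKernel_div (d := d) (cr + cs) (w := fun _ => 0)
        tendsto_const_nhds hyx
      filter_upwards [h1.eventually_le_const one_lt_two, eventually_gt_atTop 0,
        eventually_gt_atTop (cr + cs)] with t ht ht0 htc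
      refine ae_of_all _ fun p => ?_
      have hq := heatKernel_pos ht0 (yf t - xf t)
      have htc' : 0 < t - (cr + cs) := sub_pos.2 htc
      have h2 : heatKernel d (t - (cr + cs)) (w p t) / heatKernel d t (yf t - xf t) ≤ 2 := by
        refine le_trans ?_ ht
        gcongr
        unfold heatKernel
        gcongr
        simp
      have h3 : 0 ≤ heatKernel d (t - (cr + cs)) (w p t) / heatKernel d t (yf t - xf t) :=
        div_nonneg (heatKernel_pos htc' _).le hq.le
      simp only [F]
      rw [norm_mul, norm_mul, norm_mul, Real.norm_of_nonneg (hCs _ _).1, Real.norm_of_nonneg h3,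
        Real.norm_of_nonneg (hCr _ _).1]
      gcongr
      exacts [(hCr _ _).1, (hCs _ _).2, (hCr _ _).2]
    · refine Integrable.const_mul (Integrable.norm ?_) _
      exact (Integrable.fintype_prod fun _ => hv).mul_prod (Integrable.fintype_prod fun _ => hv)
    · refine ae_of_all _ fun p => ?_
      obtain ⟨w₀, hw₀⟩ := hw p
      have h1 : Tendsto (fun t => jointDensity d (xf t) s p.1) atTop
          (𝓝 (jointDensity d x s p.1)) :=
        (((continuous_jointDensity d s).comp (Continuous.prodMk_left p.1)).tendsto x).comp hx
      have h2 : Tendsto (fun t => jointDensity d (yf t) r p.2) atTop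
          (𝓝 (jointDensity d y r p.2)) :=
        (((continuous_jointDensity d r).comp (Continuous.prodMk_left p.2)).tendsto y).comp hy
      have h3 := ((h1.mul (tendsto_heatKernel_div (cr + cs) hw₀ hyx)).mul h2).mul_const
        ((∏ i, v (p.1 i)) * ∏ j, v (p.2 j))
      convert h3 using 2
      ring
  refine hdom.congr' ?_
  have ev1 : ∀ᶠ t in atTop, ∀ i, s i < t := eventually_all.2 fun i => eventually_gt_atTop _
  have ev2 : ∀ᶠ t in atTop, ∀ j, r j < t := eventually_all.2 fun i => eventually_gt_atTop _
  have ev3 : ∀ᶠ t in atTop, ∀ i j, s i + r j < t :=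
    eventually_all.2 fun i => eventually_all.2 fun j => eventually_gt_atTop _
  filter_upwards [ev1, ev2, ev3, eventually_gt_atTop 0] with t h1 h2 h3 ht
  set τ : Fin (m + n) → ℝ := Fin.append s fun i => t - r (Fin.rev i) with hτ
  have hτm : StrictMono τ := strictMono_append_rev hs hr fun i j => by linarith [h3 i j]
  have hτt : ∀ i, τ i ∈ Set.Ioo 0 t := by
    intro i
    refine Fin.addCases (fun i => ?_) (fun i => ?_) i
    · simpa [hτ] using ⟨hs0 i, h1 i⟩
    · simpa [hτ] using ⟨h2 _, hr0 _⟩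
  have hprod : ∀ ω, (∏ i, v (X t (s i) ω)) * ∏ j, v (X t (t - r j) ω) =
      ∏ i, v (X t (τ i) ω) := by
    intro ω
    rw [Fin.prod_univ_add]
    simp only [hτ, Fin.append_left, Fin.append_right]
    congr 1
    exact (Equiv.prod_comp Fin.revPerm fun j => v (X t (t - r j) ω)).symm
  simp only [hprod]
  rw [(hX t ht).integral_comp (Φ := fun z => ∏ i, v (z i)) (hXm t) hτm hτt
      (continuous_bridgeDensity d t _ _ τ).measurable
      (bridgeDensity_nonneg ht _ _ hτm hτt) (hprodm _),
    ← (measurePreserving_appendRevEquiv (Euc d) m n).integral_comp']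
  refine integral_congr_ae (ae_of_all _ fun p => ?_)
  obtain ⟨z, q⟩ := p
  simp only [F, appendRevEquiv_apply, bridgeDensity, hτ, jointDensity_snoc_append_rev]
  rw [Fin.prod_univ_add]
  simp only [Fin.append_left, Fin.append_right]
  rw [← Equiv.prod_comp Fin.revPerm fun j => v (q j), ← sub_sub]
  simp only [Fin.revPerm_apply, w, hcs, hcr]
  ring

lemma exists_strictMono_comp_perm {k : ℕ} {s : Fin k → ℝ} (hs : Function.Injective s) :
    ∃ σ : Equiv.Perm (Fin k), StrictMono fun i => s (σ i) :=
  ⟨Tuple.sort s, (Tuple.monotone_sort s).strictMono_of_injective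
    (hs.comp (Tuple.sort s).injective)⟩

/-- Convergence of the correlations of a bridge near its two endpoints. -/
lemma tendsto_integral_prod_of_injective {d : ℕ} {v : Euc d → ℝ} (hvm : Measurable v)
    (hvb : ∃ C : ℝ, ∀ z, |v z| ≤ C) (hvs : ∃ R : ℝ, ∀ z, v z ≠ 0 → ‖z‖ ≤ R)
    {xf yf : ℝ → Euc d} {x y : Euc d} (hx : Tendsto xf atTop (𝓝 x)) (hy : Tendsto yf atTop (𝓝 y))
    {Ω : Type*} [MeasurableSpace Ω] {P : Measure Ω} {X : ℝ → ℝ → Ω → Euc d}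
    (hXm : ∀ t s, Measurable (X t s))
    (hX : ∀ t, 0 < t → HasDensities P (X t) (Set.Ioo 0 t)
      fun _ => bridgeDensity d t (xf t) (yf t))
    {Ω' : Type*} [MeasurableSpace Ω'] {P' : Measure Ω'} {W W' : ℝ → Ω' → Euc d}
    (hWm : ∀ s, Measurable (W s)) (hWm' : ∀ s, Measurable (W' s))
    (hW : HasDensities P' W (Set.Ioi 0) fun _ => jointDensity d x)
    (hW' : HasDensities P' W' (Set.Ioi 0) fun _ => jointDensity d y)
    {m n : ℕ} {s : Fin m → ℝ} {r : Fin n → ℝ} (hs : Function.Injective s)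
    (hr : Function.Injective r) (hs0 : ∀ i, 0 < s i) (hr0 : ∀ i, 0 < r i) :
    Tendsto (fun t => ∫ ω, (∏ i, v (X t (s i) ω)) * ∏ j, v (X t (t - r j) ω) ∂P) atTop
      (𝓝 ((∫ ω, ∏ i, v (W (s i) ω) ∂P') * ∫ ω, ∏ j, v (W' (r j) ω) ∂P')) := by
  obtain ⟨σ, hσ⟩ := exists_strictMono_comp_perm hs
  obtain ⟨ρ, hρ⟩ := exists_strictMono_comp_perm hr
  have h := tendsto_integral_prod_of_strictMono hvm hvb hvs hx hy hXm hX hWm hWm' hW hW' hσ hρ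
    (fun i => hs0 _) (fun i => hr0 _)
  have e1 : ∀ t ω, ∏ i, v (X t (s (σ i)) ω) = ∏ i, v (X t (s i) ω) := fun t ω =>
    Equiv.prod_comp σ fun i => v (X t (s i) ω)
  have e2 : ∀ t ω, ∏ i, v (X t (t - r (ρ i)) ω) = ∏ i, v (X t (t - r i) ω) := fun t ω =>
    Equiv.prod_comp ρ fun i => v (X t (t - r i) ω)
  have e3 : ∀ ω, ∏ i, v (W (s (σ i)) ω) = ∏ i, v (W (s i) ω) := fun ω =>
    Equiv.prod_comp σ fun i => v (W (s i) ω)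
  have e4 : ∀ ω, ∏ i, v (W' (r (ρ i)) ω) = ∏ i, v (W' (r i) ω) := fun ω =>
    Equiv.prod_comp ρ fun i => v (W' (r i) ω)
  simpa only [e1, e2, e3, e4] using h

lemma ae_pi_injective_and_mem (k : ℕ) (I : Set ℝ) (hI : MeasurableSet I) :
    ∀ᵐ s : Fin k → ℝ ∂(Measure.pi fun _ => (volume : Measure ℝ).restrict I),
      Function.Injective s ∧ ∀ i, s i ∈ I := by
  rw [← Measure.restrict_pi_pi]
  have h1 : ∀ᵐ s : Fin k → ℝ ∂((Measure.pi fun _ => (volume : Measure ℝ)).restrict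
      (Set.univ.pi fun _ => I)), s ∈ Set.univ.pi fun _ => I :=
    ae_restrict_mem (MeasurableSet.univ_pi fun _ => hI)
  have h2 : ∀ i j : Fin k, i ≠ j → ∀ᵐ s : Fin k → ℝ, s i ≠ s j := by
    intro i j hij
    let S : Submodule ℝ (Fin k → ℝ) :=
      LinearMap.ker (LinearMap.proj (R := ℝ) (φ := fun _ : Fin k => ℝ) i - LinearMap.proj j)
    have hS : S ≠ ⊤ := by
      intro h
      have : Pi.single i (1 : ℝ) ∈ S := h ▸ Submodule.mem_top
      simp [S, LinearMap.mem_ker, hij.symm] at this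
    rw [ae_iff]
    refine measure_mono_null (fun s hs => ?_) (Measure.addHaar_submodule volume S hS)
    simp only [not_not, Set.mem_ofPred_eq] at hs
    simp [S, LinearMap.mem_ker, hs]
  have h3 : ∀ᵐ s : Fin k → ℝ, ∀ i j : Fin k, i ≠ j → s i ≠ s j := by
    simpa only [ae_all_iff] using h2
  filter_upwards [h1, ae_restrict_of_ae h3] with s hs hs'
  exact ⟨fun i j hij => by_contra fun h => hs' i j h hij, fun i => hs i (Set.mem_univ i)⟩

lemma measurable_prod_uncurry {Ω : Type*} [MeasurableSpace Ω] {A : ℝ → Ω → ℝ}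
    (hA : Measurable (Function.uncurry A)) (m : ℕ) :
    Measurable fun p : (Fin m → ℝ) × Ω => ∏ i, A (p.1 i) p.2 :=
  Finset.measurable_prod _ fun i _ => hA.comp
    (g := Function.uncurry A) (f := fun p : (Fin m → ℝ) × Ω => (p.1 i, p.2))
    (((measurable_pi_apply i).comp measurable_fst).prodMk measurable_snd)

lemma abs_prod_le_pow {k : ℕ} {f : Fin k → ℝ} {C : ℝ} (h : ∀ i, |f i| ≤ C) :
    |∏ i, f i| ≤ C ^ k := by
  rw [Finset.abs_prod]
  simpa using Finset.prod_le_prod (s := Finset.univ) (fun i _ => abs_nonneg (f i))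
    fun i _ => h i

/-- The mixed moments of two path integrals are integrals of correlations. -/
lemma integral_pow_mul_pow {Ω : Type*} [MeasurableSpace Ω] {P : Measure Ω} [IsFiniteMeasure P]
    {μ : Measure ℝ} [IsFiniteMeasure μ] {A B : ℝ → Ω → ℝ} {C : ℝ}
    (hA : Measurable (Function.uncurry A)) (hB : Measurable (Function.uncurry B))
    (hAC : ∀ s ω, |A s ω| ≤ C) (hBC : ∀ s ω, |B s ω| ≤ C) (m n : ℕ) :
    ∫ ω, (∫ s, A s ω ∂μ) ^ m * (∫ s, B s ω ∂μ) ^ n ∂P =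
      ∫ p : (Fin m → ℝ) × (Fin n → ℝ), (∫ ω, (∏ i, A (p.1 i) ω) * ∏ j, B (p.2 j) ω ∂P)
        ∂((Measure.pi fun _ => μ).prod (Measure.pi fun _ => μ)) := by
  have h1 : ∀ ω, (∫ s, A s ω ∂μ) ^ m * (∫ s, B s ω ∂μ) ^ n =
      ∫ p : (Fin m → ℝ) × (Fin n → ℝ), (∏ i, A (p.1 i) ω) * ∏ j, B (p.2 j) ω
        ∂((Measure.pi fun _ => μ).prod (Measure.pi fun _ => μ)) := by
    intro ω
    rw [integral_prod_mul (fun s : Fin m → ℝ => ∏ i, A (s i) ω)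
      (fun s : Fin n → ℝ => ∏ i, B (s i) ω), integral_fintype_prod_eq_pow (fun s => A s ω),
      integral_fintype_prod_eq_pow (fun s => B s ω)]
    simp
  simp only [h1]
  refine integral_integral_swap (Integrable.of_bound (C := C ^ m * C ^ n)
    (Measurable.aestronglyMeasurable ?_) (ae_of_all _ fun q => ?_))
  · exact ((measurable_prod_uncurry hA m).comp ((measurable_fst.comp measurable_snd).prodMk
      measurable_fst)).mul ((measurable_prod_uncurry hB n).comp
      ((measurable_snd.comp measurable_snd).prodMk measurable_fst))
  · rw [Function.uncurry, Real.norm_eq_abs, abs_mul]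
    have hA' := abs_prod_le_pow fun i => hAC (q.2.1 i) q.1
    have hB' := abs_prod_le_pow fun i => hBC (q.2.2 i) q.1
    exact mul_le_mul hA' hB' (abs_nonneg _) ((abs_nonneg _).trans hA')

lemma measurable_integral_path {Ω : Type*} [MeasurableSpace Ω] {μ : Measure ℝ} [SFinite μ]
    {A : ℝ → Ω → ℝ} (hA : Measurable (Function.uncurry A)) :
    Measurable fun ω => ∫ s, A s ω ∂μ :=
  (hA.stronglyMeasurable.integral_prod_left' (μ := μ)).measurable

lemma abs_integral_path_le {Ω : Type*} {μ : Measure ℝ} [IsFiniteMeasure μ] {A : ℝ → Ω → ℝ} {C : ℝ}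
    (hAC : ∀ s ω, |A s ω| ≤ C) (ω : Ω) : |∫ s, A s ω ∂μ| ≤ C * μ.real Set.univ :=
  norm_integral_le_of_norm_le_const (f := fun s => A s ω) (ae_of_all _ fun s => hAC s ω)

lemma integral_add_pow {Ω : Type*} [MeasurableSpace Ω] {P : Measure Ω} [IsFiniteMeasure P]
    {μ : Measure ℝ} [IsFiniteMeasure μ] {A B : ℝ → Ω → ℝ} {C : ℝ}
    (hA : Measurable (Function.uncurry A)) (hB : Measurable (Function.uncurry B))
    (hAC : ∀ s ω, |A s ω| ≤ C) (hBC : ∀ s ω, |B s ω| ≤ C) (k : ℕ) :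
    ∫ ω, (∫ s, A s ω ∂μ + ∫ s, B s ω ∂μ) ^ k ∂P =
      ∑ m ∈ Finset.range (k + 1),
        (∫ ω, (∫ s, A s ω ∂μ) ^ m * (∫ s, B s ω ∂μ) ^ (k - m) ∂P) * (k.choose m : ℝ) := by
  simp only [add_pow]
  rw [integral_finsetSum]
  · simp only [integral_mul_const]
  · intro m _
    refine Integrable.mul_const (Integrable.of_bound
      (C := (C * μ.real Set.univ) ^ m * (C * μ.real Set.univ) ^ (k - m))
      (Measurable.aestronglyMeasurable (((measurable_integral_path hA).pow_const _).mul
        ((measurable_integral_path hB).pow_const _))) (ae_of_all _ fun ω => ?_)) _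
    rw [Pi.mul_apply, norm_mul, norm_pow, norm_pow]
    have hA' := abs_integral_path_le (μ := μ) hAC ω
    have hB' := abs_integral_path_le (μ := μ) hBC ω
    have h0 := (abs_nonneg _).trans hA'
    gcongr
    exacts [hA', hB']

/-- Convergence of the moments of a bridge path integral restricted to times near the two
endpoints. -/
lemma tendsto_integral_truncated_pow {d : ℕ} {v : Euc d → ℝ} (hvm : Measurable v)
    (hvb : ∃ C : ℝ, ∀ z, |v z| ≤ C) (hvs : ∃ R : ℝ, ∀ z, v z ≠ 0 → ‖z‖ ≤ R)
    {xf yf : ℝ → Euc d} {x y : Euc d} (hx : Tendsto xf atTop (𝓝 x)) (hy : Tendsto yf atTop (𝓝 y))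
    {Ω : Type*} [MeasurableSpace Ω] {P : Measure Ω} [IsProbabilityMeasure P]
    {X : ℝ → ℝ → Ω → Euc d} (hXm : ∀ t, Measurable (Function.uncurry (X t)))
    (hX : ∀ t, 0 < t → HasDensities P (X t) (Set.Ioo 0 t)
      fun _ => bridgeDensity d t (xf t) (yf t))
    {Ω' : Type*} [MeasurableSpace Ω'] {P' : Measure Ω'} [IsProbabilityMeasure P']
    {W W' : ℝ → Ω' → Euc d}
    (hWm : Measurable (Function.uncurry W)) (hWm' : Measurable (Function.uncurry W'))
    (hW : HasDensities P' W (Set.Ioi 0) fun _ => jointDensity d x)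
    (hW' : HasDensities P' W' (Set.Ioi 0) fun _ => jointDensity d y)
    (hind : IndepFun (fun ω s => W s ω) (fun ω s => W' s ω) P') (T : ℝ) (k : ℕ) :
    Tendsto (fun t => ∫ ω, ((∫ s in Set.Ioo 0 T, v (X t s ω)) +
        ∫ s in Set.Ioo 0 T, v (X t (t - s) ω)) ^ k ∂P) atTop
      (𝓝 (∫ ω, ((∫ s in Set.Ioo 0 T, v (W s ω)) + ∫ s in Set.Ioo 0 T, v (W' s ω)) ^ k ∂P')) := by
  obtain ⟨C, hC⟩ := hvb
  have hXs : ∀ t s, Measurable (X t s) := fun t s => (hXm t).of_uncurry_left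
  have hXm' : ∀ t, Measurable (Function.uncurry fun s ω => v (X t s ω)) := fun t =>
    hvm.comp (hXm t)
  have hXr : ∀ t, Measurable (Function.uncurry fun s ω => v (X t (t - s) ω)) := fun t =>
    hvm.comp ((hXm t).comp ((measurable_fst.const_sub t).prodMk measurable_snd))
  have hWv : Measurable (Function.uncurry fun s ω => v (W s ω)) := hvm.comp hWm
  have hWv' : Measurable (Function.uncurry fun s ω => v (W' s ω)) := hvm.comp hWm'
  rw [integral_add_pow hWv hWv' (fun _ _ => hC _) (fun _ _ => hC _)]
  have e : ∀ t, ∫ ω, ((∫ s in Set.Ioo 0 T, v (X t s ω)) +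
        ∫ s in Set.Ioo 0 T, v (X t (t - s) ω)) ^ k ∂P = _ := fun t =>
    integral_add_pow (hXm' t) (hXr t) (fun _ _ => hC _) (fun _ _ => hC _) k
  simp only [e]
  refine tendsto_finsetSum _ fun m _ => Tendsto.mul_const _ ?_
  rw [integral_pow_mul_pow hWv hWv' (fun _ _ => hC _) (fun _ _ => hC _)]
  have e' : ∀ t, ∫ ω, (∫ s in Set.Ioo 0 T, v (X t s ω)) ^ m *
        (∫ s in Set.Ioo 0 T, v (X t (t - s) ω)) ^ (k - m) ∂P = _ := fun t =>
    integral_pow_mul_pow (hXm' t) (hXr t) (fun _ _ => hC _) (fun _ _ => hC _) m (k - m)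
  simp only [e']
  refine tendsto_integral_filter_of_dominated_convergence
    (fun _ => C ^ m * C ^ (k - m)) ?_ ?_ (integrable_const _) ?_
  · refine Eventually.of_forall fun t => ?_
    have h : Measurable fun q : ((Fin m → ℝ) × (Fin (k - m) → ℝ)) × Ω =>
        (∏ i, v (X t (q.1.1 i) q.2)) * ∏ j, v (X t (t - q.1.2 j) q.2) :=
      ((measurable_prod_uncurry (hXm' t) m).comp ((measurable_fst.comp measurable_fst).prodMk
        measurable_snd)).mul ((measurable_prod_uncurry (hXr t) (k - m)).comp
        ((measurable_snd.comp measurable_fst).prodMk measurable_snd))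
    exact h.stronglyMeasurable.integral_prod_right'.aestronglyMeasurable
  · refine Eventually.of_forall fun t => ae_of_all _ fun p => ?_
    have h : ∀ ω, ‖(∏ i, v (X t (p.1 i) ω)) * ∏ j, v (X t (t - p.2 j) ω)‖ ≤
        C ^ m * C ^ (k - m) := by
      intro ω
      rw [Real.norm_eq_abs, abs_mul]
      have h1 := abs_prod_le_pow fun i => hC (X t (p.1 i) ω)
      have h2 := abs_prod_le_pow fun i => hC (X t (t - p.2 i) ω)
      exact mul_le_mul h1 h2 (abs_nonneg _) ((abs_nonneg _).trans h1)
    simpa using norm_integral_le_of_norm_le_const (μ := P) (ae_of_all _ h)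
  · have hm := ae_pi_injective_and_mem m (Set.Ioo 0 T) measurableSet_Ioo
    have hn := ae_pi_injective_and_mem (k - m) (Set.Ioo 0 T) measurableSet_Ioo
    have hm' := (Measure.quasiMeasurePreserving_fst (ν := Measure.pi fun _ : Fin (k - m) =>
      (volume : Measure ℝ).restrict (Set.Ioo 0 T))).ae hm
    have hn' := (Measure.quasiMeasurePreserving_snd (μ := Measure.pi fun _ : Fin m =>
      (volume : Measure ℝ).restrict (Set.Ioo 0 T))).ae hn
    filter_upwards [hm', hn'] with p hp hp'
    have h := tendsto_integral_prod_of_injective hvm ⟨C, hC⟩ hvs hx hy hXs hX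
      (fun s => hWm.of_uncurry_left) (fun s => hWm'.of_uncurry_left) hW hW' hp.1 hp'.1
      (fun i => (hp.2 i).1) (fun i => (hp'.2 i).1)
    have hprodm : ∀ {k : ℕ} (s : Fin k → ℝ), Measurable fun g : ℝ → Euc d => ∏ i, v (g (s i)) :=
      fun s => Finset.measurable_prod _ fun i _ => hvm.comp (measurable_pi_apply _)
    have hi := hind.comp (hprodm p.1) (hprodm p.2)
    have hi' := hi.integral_mul_eq_mul_integral
      ((hprodm p.1).comp (measurable_pi_lambda _ fun s =>
        hWm.of_uncurry_left)).aestronglyMeasurable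
      ((hprodm p.2).comp (measurable_pi_lambda _ fun s =>
        hWm'.of_uncurry_left)).aestronglyMeasurable
    simp only [Function.comp_def, Pi.mul_apply] at hi'
    rw [hi']
    exact h

/-- The indicator of the closed ball of radius `R` around the origin. -/
def ballInd (d : ℕ) (R : ℝ) : Euc d → ENNReal := (Metric.closedBall 0 R).indicator 1

lemma measurable_ballInd (d : ℕ) (R : ℝ) : Measurable (ballInd d R) :=
  measurable_one.indicator measurableSet_closedBall

lemma ballInd_le_one (d : ℕ) (R : ℝ) (z : Euc d) : ballInd d R z ≤ 1 :=
  Set.indicator_le_self' (fun _ _ => zero_le) z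

/-- A bound, as a function of the time gap, of the transition probability into the closed ball of
radius `R`. -/
def gapBound (d : ℕ) (R : ℝ) (u : ℝ) : ENNReal :=
  min 1 (ENNReal.ofReal ((π * |u|) ^ (-(d : ℝ) / 2)) * volume (Metric.closedBall (0 : Euc d) R))

lemma measurable_gapBound (d : ℕ) (R : ℝ) : Measurable (gapBound d R) := by
  unfold gapBound; fun_prop

lemma bridgeDensity_snoc_le {d k : ℕ} {t : ℝ} (a b : Euc d) {s : Fin k → ℝ} {u : ℝ}
    (hs : StrictMono s) (h0 : ∀ i, 0 < s i) (hsu : ∀ i, s i < u) (hu0 : 0 < u) (hut : u < t)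
    (z : Fin k → Euc d) (w : Euc d) :
    bridgeDensity d t a b (Fin.snoc s u) (Fin.snoc z w) ≤
      ((π * (u - (Fin.cons 0 s : Fin (k + 1) → ℝ) (Fin.last k))) ^ (-(d : ℝ) / 2) +
        (π * (t - u)) ^ (-(d : ℝ) / 2)) * bridgeDensity d t a b s z := by
  have hα : 0 < u - (Fin.cons 0 s : Fin (k + 1) → ℝ) (Fin.last k) := by
    have h := sub_cons_castSucc_pos (strictMono_snoc hs hsu) (snoc_pos h0 hu0) (Fin.last k)
    rwa [Fin.cons_snoc_eq_snoc_cons, Fin.snoc_castSucc, Fin.snoc_last] at h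
  have hβ : 0 < t - u := sub_pos.2 hut
  unfold bridgeDensity
  rw [jointDensity_snoc, jointDensity_snoc, jointDensity_snoc, Fin.cons_snoc_eq_snoc_cons,
    Fin.cons_snoc_eq_snoc_cons, Fin.snoc_last, Fin.snoc_last, ← mul_div_assoc]
  refine div_le_div_of_nonneg_right ?_ (heatKernel_pos (hu0.trans hut) _).le
  set α := u - (Fin.cons 0 s : Fin (k + 1) → ℝ) (Fin.last k)
  have h := heatKernel_mul_div_le hα hβ
    (w - (Fin.cons a z : Fin (k + 1) → Euc d) (Fin.last k)) (b - w)
  have e1 : α + (t - u) = t - (Fin.cons 0 s : Fin (k + 1) → ℝ) (Fin.last k) := by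
    simp only [α]; ring
  have e2 : w - (Fin.cons a z : Fin (k + 1) → Euc d) (Fin.last k) + (b - w) =
      b - (Fin.cons a z : Fin (k + 1) → Euc d) (Fin.last k) := by abel
  rw [e2, div_le_iff₀ (heatKernel_pos (by positivity) _), e1] at h
  have hJ := (jointDensity_pos hs h0 a z).le
  calc _ = jointDensity d a s z * (heatKernel d α
          (w - (Fin.cons a z : Fin (k + 1) → Euc d) (Fin.last k)) *
          heatKernel d (t - u) (b - w)) := by ring
    _ ≤ jointDensity d a s z * _ := mul_le_mul_of_nonneg_left h hJ
    _ = _ := by ring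

lemma measurable_prod_ballInd (d k : ℕ) (R : ℝ) :
    Measurable fun z : Fin k → Euc d => ∏ i, ballInd d R (z i) :=
  Finset.measurable_prod _ fun i _ => (measurable_ballInd d R).comp (measurable_pi_apply i)

section Moments

variable {d : ℕ} {R t : ℝ} {a b : Euc d} {Ω : Type*} [MeasurableSpace Ω] {P : Measure Ω}
  {X : ℝ → Ω → Euc d}

/-- Adding a last time costs at most a factor depending on the gaps around this time. -/
lemma lintegral_prod_mul_le_of_strictMono (hXm : ∀ s, Measurable (X s))
    (hX : HasDensities P X (Set.Ioo 0 t) fun _ => bridgeDensity d t a b) {k : ℕ}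
    {s : Fin k → ℝ} {u : ℝ} (hs : StrictMono s) (h0 : ∀ i, 0 < s i) (hsu : ∀ i, s i < u)
    (hu0 : 0 < u) (hut : u < t) :
    ∫⁻ ω, ballInd d R (X u ω) * ∏ i, ballInd d R (X (s i) ω) ∂P ≤
      (gapBound d R (u - (Fin.cons 0 s : Fin (k + 1) → ℝ) (Fin.last k)) +
        gapBound d R (t - u)) * ∫⁻ ω, ∏ i, ballInd d R (X (s i) ω) ∂P := by
  set I := ∫⁻ ω, ballInd d R (X u ω) * ∏ i, ballInd d R (X (s i) ω) ∂P with hI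
  set J := ∫⁻ ω, ∏ i, ballInd d R (X (s i) ω) ∂P with hJ
  set α := u - (Fin.cons 0 s : Fin (k + 1) → ℝ) (Fin.last k) with hαdef
  have hα : 0 < α := by
    have h := sub_cons_castSucc_pos (strictMono_snoc hs hsu) (snoc_pos h0 hu0) (Fin.last k)
    rwa [Fin.cons_snoc_eq_snoc_cons, Fin.snoc_castSucc, Fin.snoc_last] at h
  have h1 : I ≤ J := lintegral_mono fun ω => mul_le_of_le_one_left' (ballInd_le_one _ _ _)
  set A := ENNReal.ofReal ((π * |α|) ^ (-(d : ℝ) / 2)) *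
    volume (Metric.closedBall (0 : Euc d) R) with hA
  set B := ENNReal.ofReal ((π * |t - u|) ^ (-(d : ℝ) / 2)) *
    volume (Metric.closedBall (0 : Euc d) R) with hB
  have h2 : I ≤ (A + B) * J := by
    have e : ∀ ω, ballInd d R (X u ω) * ∏ i, ballInd d R (X (s i) ω) =
        ∏ i, ballInd d R (X ((Fin.snoc s u : Fin (k + 1) → ℝ) i) ω) := by
      intro ω
      rw [Fin.prod_univ_castSucc, mul_comm]
      simp
    rw [hI, hJ]
    simp only [e]
    have hbm : ∀ {m : ℕ} (s : Fin m → ℝ), Measurable fun z : Fin m → Euc d =>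
        ENNReal.ofReal (bridgeDensity d t a b s z) * ∏ i, ballInd d R (z i) := fun s =>
      (continuous_bridgeDensity d t _ _ _).measurable.ennreal_ofReal.mul
        (measurable_prod_ballInd _ _ _)
    rw [hX.lintegral_comp (Φ := fun z => ∏ i, ballInd d R (z i)) hXm (strictMono_snoc hs hsu)
        (fun i => ⟨snoc_pos h0 hu0 i, by
          refine Fin.lastCases ?_ (fun i => ?_) i
          · simpa using hut
          · simpa using (hsu i).trans hut⟩)
        (continuous_bridgeDensity d t _ _ _).measurable (measurable_prod_ballInd _ _ _),
      hX.lintegral_comp (Φ := fun z => ∏ i, ballInd d R (z i)) hXm hs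
        (fun i => ⟨h0 i, (hsu i).trans hut⟩)
        (continuous_bridgeDensity d t _ _ _).measurable (measurable_prod_ballInd _ _ _),
      ← (volume_preserving_piFinSuccAbove (fun _ : Fin (k + 1) => Euc d)
        (Fin.last k)).symm.lintegral_comp (hbm _)]
    have hball : ∫⁻ w, ballInd d R w = volume (Metric.closedBall (0 : Euc d) R) :=
      lintegral_indicator_one measurableSet_closedBall
    calc _ ≤ ∫⁻ p : Euc d × (Fin k → Euc d), (ENNReal.ofReal ((π * |α|) ^ (-(d : ℝ) / 2) +
            (π * |t - u|) ^ (-(d : ℝ) / 2)) * ballInd d R p.1) *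
            (ENNReal.ofReal (bridgeDensity d t a b s p.2) * ∏ i, ballInd d R (p.2 i)) := by
          refine lintegral_mono fun p => ?_
          obtain ⟨w, z⟩ := p
          have e2 : (MeasurableEquiv.piFinSuccAbove (fun _ => Euc d) (Fin.last k)).symm (w, z) =
              Fin.snoc z w := by
            rw [MeasurableEquiv.piFinSuccAbove_symm_apply]
            exact Fin.insertNth_last' w z
          rw [e2, Fin.prod_univ_castSucc]
          simp only [Fin.snoc_castSucc, Fin.snoc_last]
          have h3 := ENNReal.ofReal_le_ofReal
            (bridgeDensity_snoc_le a b hs h0 hsu hu0 hut z w)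
          rw [ENNReal.ofReal_mul (by have := sub_pos.2 hut; positivity)] at h3
          rw [abs_of_pos hα, abs_of_pos (sub_pos.2 hut)]
          calc _ ≤ _ := mul_le_mul_left h3 _
            _ = _ := by ring
      _ = (A + B) * _ := by
          rw [show (volume : Measure (Euc d × (Fin k → Euc d))) = volume.prod volume from rfl,
            lintegral_prod_mul (f := fun w => ENNReal.ofReal ((π * |α|) ^ (-(d : ℝ) / 2) +
              (π * |t - u|) ^ (-(d : ℝ) / 2)) * ballInd d R w)
              (g := fun z => ENNReal.ofReal (bridgeDensity d t a b s z) *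
                ∏ i, ballInd d R (z i))
              ((measurable_ballInd d R).const_mul _).aemeasurable
              (hbm s).aemeasurable,
            lintegral_const_mul _ (measurable_ballInd d R), hball,
            ENNReal.ofReal_add (by positivity) (by positivity), add_mul, ← hA, ← hB]
  unfold gapBound
  rw [← hA, ← hB]
  rcases le_total 1 A with hA1 | hA1
  · rw [min_eq_left hA1]
    exact h1.trans (le_mul_of_one_le_left' le_self_add)
  · rcases le_total 1 B with hB1 | hB1
    · rw [min_eq_left hB1]
      exact h1.trans (le_mul_of_one_le_left' le_add_self)
    · rwa [min_eq_right hA1, min_eq_right hB1]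

lemma lintegral_ballInd_le [IsProbabilityMeasure P] (hXm : ∀ s, Measurable (X s))
    (hX : HasDensities P X (Set.Ioo 0 t) fun _ => bridgeDensity d t a b) {u : ℝ}
    (hu0 : 0 < u) (hut : u < t) :
    ∫⁻ ω, ballInd d R (X u ω) ∂P ≤ gapBound d R u + gapBound d R (t - u) := by
  simpa using lintegral_prod_mul_le_of_strictMono (R := R) hXm hX (s := fun i : Fin 0 => i.elim0)
    (fun i => i.elim0) (fun i => i.elim0) (fun i => i.elim0) hu0 hut

lemma lintegral_prod_le_sum (hXm : ∀ s, Measurable (X s))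
    (hX : HasDensities P X (Set.Ioo 0 t) fun _ => bridgeDensity d t a b) {k : ℕ}
    {s : Fin (k + 1) → ℝ} (hs : Function.Injective s) (hst : ∀ i, s i ∈ Set.Ioo 0 t) :
    ∫⁻ ω, ∏ i, ballInd d R (X (s i) ω) ∂P ≤
      ∑ j, (∫⁻ ω, ∏ i, ballInd d R (X (s (j.succAbove i)) ω) ∂P) *
        (gapBound d R (s j) + ∑ i, gapBound d R (s j - s (j.succAbove i)) +
          gapBound d R (t - s j)) := by
  obtain ⟨j, hj⟩ := Finite.exists_max s
  refine le_trans ?_ (Finset.single_le_sum (f := fun j =>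
    (∫⁻ ω, ∏ i, ballInd d R (X (s (j.succAbove i)) ω) ∂P) *
        (gapBound d R (s j) + ∑ i, gapBound d R (s j - s (j.succAbove i)) +
          gapBound d R (t - s j))) (fun _ _ => zero_le) (Finset.mem_univ j))
  obtain ⟨σ, hσ⟩ := exists_strictMono_comp_perm (s := fun i => s (j.succAbove i))
    (hs.comp Fin.succAbove_right_injective)
  have h := lintegral_prod_mul_le_of_strictMono (R := R) hXm hX hσ (fun i => (hst _).1)
    (fun i => (hj _).lt_of_ne fun h => Fin.succAbove_ne _ _ (hs h)) (hst j).1 (hst j).2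
  have e : ∀ ω, ∏ i, ballInd d R (X (s (j.succAbove (σ i))) ω) =
      ∏ i, ballInd d R (X (s (j.succAbove i)) ω) := fun ω =>
    Equiv.prod_comp σ fun i => ballInd d R (X (s (j.succAbove i)) ω)
  simp only [e] at h
  simp only [Fin.prod_univ_succAbove _ j]
  refine h.trans ?_
  rw [mul_comm]
  gcongr
  refine Fin.cases (motive := fun l => gapBound d R (s j -
    (Fin.cons 0 (fun i => s (j.succAbove (σ i))) : Fin (k + 1) → ℝ) l) ≤ _) ?_ (fun i => ?_)
    (Fin.last k)
  · simp
  · rw [Fin.cons_succ]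
    exact (Finset.single_le_sum (f := fun i => gapBound d R (s j - s (j.succAbove i)))
      (fun _ _ => zero_le) (Finset.mem_univ (σ i))).trans le_add_self

lemma lintegral_pi_prod_le [SFinite P] (hXm : Measurable (Function.uncurry X))
    (hX : HasDensities P X (Set.Ioo 0 t) fun _ => bridgeDensity d t a b) (k : ℕ) :
    ∫⁻ s : Fin k → ℝ, (∫⁻ ω, ∏ i, ballInd d R (X (s i) ω) ∂P)
        ∂(Measure.pi fun _ => (volume : Measure ℝ).restrict (Set.Ioo 0 t)) ≤
      (∏ i ∈ Finset.range k, ((i + 1 : ℕ) * ((i + 2 : ℕ) * ∫⁻ u, gapBound d R u))) *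
        P Set.univ := by
  induction k with
  | zero => simp
  | succ k ih =>
    set μ := (volume : Measure ℝ).restrict (Set.Ioo 0 t) with hμ
    set H := ∫⁻ u, gapBound d R u with hH
    have hg := measurable_gapBound d R
    let f : (Fin k → ℝ) → ENNReal := fun s => ∫⁻ ω, ∏ i, ballInd d R (X (s i) ω) ∂P
    have hf : Measurable f := by
      have h : Measurable fun p : (Fin k → ℝ) × Ω => ∏ i, ballInd d R (X (p.1 i) p.2) :=
        Finset.measurable_prod _ fun i _ => (measurable_ballInd d R).comp (hXm.comp
          (g := Function.uncurry X) (f := fun p : (Fin k → ℝ) × Ω => (p.1 i, p.2))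
          (((measurable_pi_apply i).comp measurable_fst).prodMk measurable_snd))
      exact h.lintegral_prod_right' (ν := P)
    let G : ℝ × (Fin k → ℝ) → ENNReal := fun p =>
      f p.2 * (gapBound d R p.1 + ∑ i, gapBound d R (p.1 - p.2 i) + gapBound d R (t - p.1))
    have hG : Measurable G := by
      refine (hf.comp measurable_snd).mul (((hg.comp measurable_fst).add
        (Finset.measurable_sum _ fun i _ => hg.comp (measurable_fst.sub
          ((measurable_pi_apply i).comp measurable_snd)))).add
        (hg.comp (measurable_fst.const_sub t)))
    have hGint : ∫⁻ p, G p ∂(μ.prod (Measure.pi fun _ => μ)) ≤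
        ((k + 2 : ℕ) * H) * ∫⁻ s, f s ∂(Measure.pi fun _ => μ) := by
      rw [lintegral_prod_symm _ hG.aemeasurable, ← lintegral_const_mul _ hf]
      refine lintegral_mono fun s => ?_
      simp only [G]
      have hm1 : ∀ i, Measurable fun u => gapBound d R (u - s i) := fun i =>
        hg.comp (measurable_id.sub_const _)
      have hm2 : Measurable fun u => ∑ i, gapBound d R (u - s i) :=
        Finset.measurable_sum _ fun i _ => hm1 i
      have hm3 : Measurable fun u => gapBound d R (t - u) := hg.comp (measurable_id.const_sub t)
      have hm4 : Measurable fun u => gapBound d R u + ∑ i, gapBound d R (u - s i) := hg.add hm2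
      have hm5 : Measurable fun u =>
          gapBound d R u + ∑ i, gapBound d R (u - s i) + gapBound d R (t - u) := hm4.add hm3
      rw [lintegral_const_mul _ hm5, mul_comm (((k + 2 : ℕ) : ENNReal) * H)]
      gcongr
      calc _ ≤ ∫⁻ u, (gapBound d R u + ∑ i, gapBound d R (u - s i) + gapBound d R (t - u)) :=
            lintegral_mono' Measure.restrict_le_self le_rfl
        _ = (k + 2 : ℕ) * H := by
            rw [lintegral_add_left hm4, lintegral_add_left hg,
              lintegral_finsetSum _ fun i _ => hm1 i, lintegral_sub_left_eq_self (gapBound d R)]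
            simp only [lintegral_sub_right_eq_self (gapBound d R), Finset.sum_const,
              Finset.card_univ, Fintype.card_fin, ← hH]
            rw [nsmul_eq_mul]
            push_cast
            ring
    calc _ ≤ ∫⁻ s : Fin (k + 1) → ℝ, ∑ j, G (MeasurableEquiv.piFinSuccAbove (fun _ => ℝ) j s)
            ∂(Measure.pi fun _ => μ) := by
          refine lintegral_mono_ae ?_
          filter_upwards [ae_pi_injective_and_mem (k + 1) (Set.Ioo 0 t) measurableSet_Ioo]
            with s hs
          exact lintegral_prod_le_sum (fun s => hXm.of_uncurry_left) hX hs.1 hs.2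
      _ = ∑ j : Fin (k + 1), ∫⁻ p, G p ∂(μ.prod (Measure.pi fun _ => μ)) := by
          have hGj : ∀ j ∈ (Finset.univ : Finset (Fin (k + 1))), Measurable fun s =>
              G (MeasurableEquiv.piFinSuccAbove (fun _ => ℝ) j s) := fun j _ =>
            hG.comp (MeasurableEquiv.piFinSuccAbove (fun _ => ℝ) j).measurable
          rw [lintegral_finsetSum _ hGj]
          refine Finset.sum_congr rfl fun j _ => ?_
          exact (measurePreserving_piFinSuccAbove (fun _ : Fin (k + 1) => μ) j).lintegral_comp hG
      _ ≤ (k + 1 : ℕ) * (((k + 2 : ℕ) * H) * ∫⁻ s, f s ∂(Measure.pi fun _ => μ)) := by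
          rw [Finset.sum_const, Finset.card_univ, Fintype.card_fin, nsmul_eq_mul]
          gcongr
      _ ≤ (k + 1 : ℕ) * (((k + 2 : ℕ) * H) *
          ((∏ i ∈ Finset.range k, ((i + 1 : ℕ) * ((i + 2 : ℕ) * H))) * P Set.univ)) := by gcongr
      _ = _ := by rw [Finset.prod_range_succ]; ring

end Moments

lemma lintegral_pow_eq_lintegral_pi (μ : Measure ℝ) [SigmaFinite μ] {f : ℝ → ENNReal}
    (hf : Measurable f) (k : ℕ) :
    (∫⁻ s, f s ∂μ) ^ k = ∫⁻ s : Fin k → ℝ, ∏ i, f (s i) ∂(Measure.pi fun _ => μ) := by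
  induction k with
  | zero => simp
  | succ k ih =>
    have hk : Measurable fun s : Fin k → ℝ => ∏ i, f (s i) :=
      Finset.measurable_prod _ fun i _ => hf.comp (measurable_pi_apply i)
    have h := (measurePreserving_piFinSuccAbove (fun _ : Fin (k + 1) => μ) 0).lintegral_comp
      (f := fun p : ℝ × (Fin k → ℝ) => f p.1 * ∏ i, f (p.2 i))
      ((hf.comp measurable_fst).mul (hk.comp measurable_snd))
    simp only [Fin.prod_univ_succAbove _ 0]
    rw [pow_succ', ih, ← lintegral_prod_mul hf.aemeasurable hk.aemeasurable]
    exact h.symm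

/-- Uniform bound for the moments of the time that a bridge spends in a ball. -/
lemma lintegral_occupation_pow_le {d : ℕ} {R t : ℝ} {a b : Euc d} {Ω : Type*} [MeasurableSpace Ω]
    {P : Measure Ω} [IsProbabilityMeasure P] {X : ℝ → Ω → Euc d}
    (hXm : Measurable (Function.uncurry X))
    (hX : HasDensities P X (Set.Ioo 0 t) fun _ => bridgeDensity d t a b) (k : ℕ) :
    ∫⁻ ω, (∫⁻ s in Set.Ioo 0 t, ballInd d R (X s ω)) ^ k ∂P ≤
      ∏ i ∈ Finset.range k, ((i + 1 : ℕ) * ((i + 2 : ℕ) * ∫⁻ u, gapBound d R u)) := by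
  have h1 : ∀ ω, (∫⁻ s in Set.Ioo 0 t, ballInd d R (X s ω)) ^ k = _ := fun ω =>
    lintegral_pow_eq_lintegral_pi (volume.restrict (Set.Ioo 0 t))
      ((measurable_ballInd d R).comp hXm.of_uncurry_right) k
  simp only [h1]
  rw [lintegral_lintegral_swap]
  · simpa using lintegral_pi_prod_le (R := R) hXm hX k
  · exact (Finset.measurable_prod _ fun i _ => (measurable_ballInd d R).comp (hXm.comp
        (g := Function.uncurry X) (f := fun p : Ω × (Fin k → ℝ) => (p.2 i, p.1))
        (((measurable_pi_apply i).comp measurable_snd).prodMk measurable_fst))).aemeasurable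

lemma lintegral_gapBound_lt_top {d : ℕ} (hd : 3 ≤ d) (R : ℝ) : ∫⁻ u, gapBound d R u < ⊤ := by
  set V := volume (Metric.closedBall (0 : Euc d) R) with hV
  set C : ENNReal := ENNReal.ofReal (2 ^ ((d : ℝ) / 2)) *
    (1 + ENNReal.ofReal (π ^ (-(d : ℝ) / 2)) * V) with hC
  have hCtop : C ≠ ⊤ := by
    have : V ≠ ⊤ := measure_closedBall_lt_top.ne
    finiteness
  have hd' : (3 : ℝ) ≤ d := by exact_mod_cast hd
  have hfin := finite_integral_one_add_norm (E := ℝ) (μ := volume) (r := (d : ℝ) / 2)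
    (by simp; linarith)
  refine lt_of_le_of_lt (b := ∫⁻ u : ℝ, C * ENNReal.ofReal ((1 + ‖u‖) ^ (-((d : ℝ) / 2)))) ?_ ?_
  · refine lintegral_mono fun u => ?_
    have hp : -((d : ℝ) / 2) ≤ 0 := by linarith
    have e2 : (2 : ℝ) ^ ((d : ℝ) / 2) = (1 / 2) ^ (-((d : ℝ) / 2)) := by
      rw [one_div, Real.inv_rpow (by norm_num), ← Real.rpow_neg (by norm_num), neg_neg]
    unfold gapBound
    rw [← hV, hC, mul_right_comm, ← ENNReal.ofReal_mul (by positivity), e2,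
      ← Real.mul_rpow (by norm_num) (by positivity), mul_add, mul_one, Real.norm_eq_abs]
    rcases le_total |u| 1 with h | h
    · refine (min_le_left _ _).trans (le_trans ?_ le_self_add)
      rw [ENNReal.one_le_ofReal]
      exact Real.one_le_rpow_of_pos_of_le_one_of_nonpos (by positivity) (by linarith) hp
    · refine (min_le_right _ _).trans (le_trans ?_ le_add_self)
      rw [← mul_assoc, ← ENNReal.ofReal_mul (by positivity), mul_comm (_ ^ _) (π ^ _), neg_div,
        ← Real.mul_rpow (by positivity) (by positivity)]
      refine mul_le_mul_left (ENNReal.ofReal_le_ofReal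
        (Real.rpow_le_rpow_of_nonpos (by positivity) ?_ hp)) V
      nlinarith [Real.pi_pos]
  · rw [lintegral_const_mul _ (by fun_prop)]
    exact ENNReal.mul_lt_top hCtop.lt_top hfin

lemma enorm_pow_succ_sub_pow_succ_le {x y : ℝ} {M : ENNReal} (hx : ‖x‖ₑ ≤ M) (hy : ‖y‖ₑ ≤ M)
    (k : ℕ) : ‖x ^ (k + 1) - y ^ (k + 1)‖ₑ ≤ (k + 1 : ℕ) * (‖x - y‖ₑ * M ^ k) := by
  induction k with
  | zero => simp
  | succ k ih =>
    have e : x ^ (k + 1 + 1) - y ^ (k + 1 + 1) =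
        x * (x ^ (k + 1) - y ^ (k + 1)) + (x - y) * y ^ (k + 1) := by ring
    calc _ ≤ ‖x‖ₑ * ‖x ^ (k + 1) - y ^ (k + 1)‖ₑ + ‖x - y‖ₑ * ‖y‖ₑ ^ (k + 1) := by
          rw [e, ← enorm_mul, ← enorm_pow, ← enorm_mul]
          exact enorm_add_le _ _
      _ ≤ M * ((k + 1 : ℕ) * (‖x - y‖ₑ * M ^ k)) + ‖x - y‖ₑ * M ^ (k + 1) := by gcongr
      _ = _ := by push_cast; ring

lemma mul_pow_le_add {D V : ENNReal} (hDV : D ≤ V) (k : ℕ) {N : ℕ} (hN : N ≠ 0) :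
    D * V ^ k ≤ N * D + (N : ENNReal)⁻¹ * V ^ (2 * k + 1) := by
  rcases le_total (V ^ k) N with h | h
  · refine le_trans ?_ le_self_add
    rw [mul_comm]
    gcongr
  · refine le_trans ?_ le_add_self
    have h1 : 1 ≤ (N : ENNReal)⁻¹ * V ^ k := by
      rw [mul_comm, ← div_eq_mul_inv, ENNReal.le_div_iff_mul_le (by simp [hN]) (by simp), one_mul]
      exact h
    calc D * V ^ k ≤ (V * V ^ k) * 1 := by rw [mul_one]; gcongr
      _ ≤ (V * V ^ k) * ((N : ENNReal)⁻¹ * V ^ k) := by gcongr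
      _ = _ := by ring

lemma setIntegral_comp_sub_left (g : ℝ → ℝ) (t T : ℝ) :
    ∫ s in Set.Ioo 0 T, g (t - s) = ∫ s in Set.Ioo (t - T) t, g s := by
  have h := (Measure.measurePreserving_sub_left (volume : Measure ℝ) t).setIntegral_preimage_emb
    (MeasurableEquiv.subLeft t).measurableEmbedding g (Set.Ioo (t - T) t)
  simpa using h

section Path

variable {d : ℕ} {v : Euc d → ℝ} {R : ℝ} {K : ENNReal}

lemma enorm_setIntegral_le (hK : K ≠ ⊤) (hv : ∀ z, ‖v z‖ₑ ≤ K * ballInd d R z) (f : ℝ → Euc d)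
    (S : Set ℝ) : ‖∫ s in S, v (f s)‖ₑ ≤ K * ∫⁻ s in S, ballInd d R (f s) := by
  rw [← lintegral_const_mul' _ _ hK]
  exact (enorm_integral_le_lintegral_enorm _).trans (lintegral_mono fun s => hv _)

lemma integrableOn_comp_path (hvm : Measurable v) (hK : K ≠ ⊤)
    (hv : ∀ z, ‖v z‖ₑ ≤ K * ballInd d R z) {f : ℝ → Euc d} (hf : Measurable f) {S : Set ℝ}
    (hS : ∫⁻ s in S, ballInd d R (f s) ≠ ⊤) : IntegrableOn (fun s => v (f s)) S := by
  refine ⟨(hvm.comp hf).aestronglyMeasurable, ?_⟩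
  refine lt_of_le_of_lt (lintegral_mono fun s => hv _) ?_
  rw [lintegral_const_mul' _ _ hK]
  exact ENNReal.mul_lt_top hK.lt_top hS.lt_top

lemma lintegral_ballInd_ne_top (f : ℝ → Euc d) {S : Set ℝ} (hS : volume S ≠ ⊤) :
    ∫⁻ s in S, ballInd d R (f s) ≠ ⊤ := by
  refine ne_top_of_le_ne_top hS ?_
  calc _ ≤ ∫⁻ s in S, 1 := lintegral_mono fun s => ballInd_le_one _ _ _
    _ = _ := by simp

lemma two_sided_integral_eq (hvm : Measurable v) (hK : K ≠ ⊤)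
    (hv : ∀ z, ‖v z‖ₑ ≤ K * ballInd d R z) {f : ℝ → Euc d} (hf : Measurable f) {t T : ℝ}
    (hTt : 2 * T ≤ t) :
    (∫ s in Set.Ioo 0 T, v (f s)) + ∫ s in Set.Ioo 0 T, v (f (t - s)) =
      ∫ s in Set.Ioo 0 T ∪ Set.Ioo (t - T) t, v (f s) := by
  have hi : ∀ a b : ℝ, IntegrableOn (fun s => v (f s)) (Set.Ioo a b) := fun a b =>
    integrableOn_comp_path hvm hK hv hf (lintegral_ballInd_ne_top f (by simp))
  rw [setIntegral_union ?_ measurableSet_Ioo (hi _ _) (hi _ _),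
    setIntegral_comp_sub_left (fun s => v (f s))]
  refine Set.disjoint_left.2 fun s h1 h2 => ?_
  have := h1.2; have := h2.1; linarith

lemma union_Ioo_subset {t T : ℝ} (hT : 0 ≤ T) (hTt : 2 * T ≤ t) :
    Set.Ioo 0 T ∪ Set.Ioo (t - T) t ⊆ Set.Ioo 0 t := by
  rintro s (h | h)
  · exact ⟨h.1, by have := h.2; linarith⟩
  · exact ⟨by have := h.1; linarith, h.2⟩

lemma enorm_two_sided_integral_le (hvm : Measurable v) (hK : K ≠ ⊤)
    (hv : ∀ z, ‖v z‖ₑ ≤ K * ballInd d R z) {f : ℝ → Euc d} (hf : Measurable f) {t T : ℝ}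
    (hT : 0 ≤ T) (hTt : 2 * T ≤ t) :
    ‖(∫ s in Set.Ioo 0 T, v (f s)) + ∫ s in Set.Ioo 0 T, v (f (t - s))‖ₑ ≤
      K * ∫⁻ s in Set.Ioo 0 t, ballInd d R (f s) := by
  rw [two_sided_integral_eq hvm hK hv hf hTt]
  refine (enorm_setIntegral_le hK hv f _).trans ?_
  gcongr
  exact union_Ioo_subset hT hTt

lemma enorm_integral_sub_two_sided_le (hvm : Measurable v) (hK : K ≠ ⊤)
    (hv : ∀ z, ‖v z‖ₑ ≤ K * ballInd d R z) {f : ℝ → Euc d} (hf : Measurable f) {t T : ℝ}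
    (hT : 0 ≤ T) (hTt : 2 * T ≤ t) :
    ‖(∫ s in Set.Ioo 0 t, v (f s)) -
        ((∫ s in Set.Ioo 0 T, v (f s)) + ∫ s in Set.Ioo 0 T, v (f (t - s)))‖ₑ ≤
      K * ∫⁻ s in Set.Ioo 0 t ∩ Set.Icc T (t - T), ballInd d R (f s) := by
  rw [two_sided_integral_eq hvm hK hv hf hTt, ← setIntegral_sdiff
    (measurableSet_Ioo.union measurableSet_Ioo)
    (integrableOn_comp_path hvm hK hv hf (lintegral_ballInd_ne_top f (by simp)))
    (union_Ioo_subset hT hTt)]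
  refine (enorm_setIntegral_le hK hv f _).trans ?_
  gcongr
  rintro s ⟨h1, h2⟩
  simp only [Set.mem_union, Set.mem_Ioo, not_or, not_and, not_lt] at h2
  refine ⟨h1, h2.1 h1.1, ?_⟩
  by_contra! h
  exact absurd h1.2 (not_lt.2 (h2.2 h))

end Path

section Bridge

variable {d : ℕ} {R t T : ℝ} {a b : Euc d} {Ω : Type*} [MeasurableSpace Ω] {P : Measure Ω}
  [IsProbabilityMeasure P] {X : ℝ → Ω → Euc d}

lemma lintegral_middle_occupation_le (hXm : Measurable (Function.uncurry X))
    (hX : HasDensities P X (Set.Ioo 0 t) fun _ => bridgeDensity d t a b) :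
    ∫⁻ ω, (∫⁻ s in Set.Ioo 0 t ∩ Set.Icc T (t - T), ballInd d R (X s ω)) ∂P ≤
      2 * ∫⁻ u in Set.Ici T, gapBound d R u := by
  have hm := measurable_gapBound d R
  have hmS : MeasurableSet (Set.Ioo 0 t ∩ Set.Icc T (t - T)) :=
    measurableSet_Ioo.inter measurableSet_Icc
  have hm2 : Measurable fun u => (Set.Ici T).indicator (gapBound d R) u :=
    hm.indicator measurableSet_Ici
  have hm3 : Measurable fun p : Ω × ℝ => ballInd d R (X p.2 p.1) :=
    (measurable_ballInd d R).comp (hXm.comp measurable_swap)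
  rw [lintegral_lintegral_swap hm3.aemeasurable]
  calc _ ≤ ∫⁻ s in Set.Ioo 0 t ∩ Set.Icc T (t - T),
        ((Set.Ici T).indicator (gapBound d R) s + (Set.Ici T).indicator (gapBound d R) (t - s)) := by
        refine setLIntegral_mono' hmS fun s hs => ?_
        have h1 : s ∈ Set.Ici T := hs.2.1
        have h2 : t - s ∈ Set.Ici T := by have := hs.2.2; simp only [Set.mem_Ici]; linarith
        rw [Set.indicator_of_mem h1, Set.indicator_of_mem h2]
        exact lintegral_ballInd_le (fun s => hXm.of_uncurry_left) hX hs.1.1 hs.1.2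
    _ ≤ ∫⁻ s, ((Set.Ici T).indicator (gapBound d R) s +
          (Set.Ici T).indicator (gapBound d R) (t - s)) :=
        lintegral_mono' Measure.restrict_le_self le_rfl
    _ = _ := by
        rw [lintegral_add_left hm2,
          lintegral_sub_left_eq_self fun u => (Set.Ici T).indicator (gapBound d R) u,
          lintegral_indicator measurableSet_Ici, two_mul]

variable {v : Euc d → ℝ} {K : ENNReal}

lemma measurable_setIntegral_comp (hvm : Measurable v) (hXm : Measurable (Function.uncurry X))
    (S : Set ℝ) : Measurable fun ω => ∫ s in S, v (X s ω) :=
  measurable_integral_path (A := fun s ω => v (X s ω)) (hvm.comp hXm)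

lemma measurable_two_sided_integral (hvm : Measurable v) (hXm : Measurable (Function.uncurry X))
    (t T : ℝ) : Measurable fun ω =>
      (∫ s in Set.Ioo 0 T, v (X s ω)) + ∫ s in Set.Ioo 0 T, v (X (t - s) ω) :=
  (measurable_setIntegral_comp hvm hXm _).add
    (measurable_setIntegral_comp (X := fun s => X (t - s)) hvm (hXm.comp
      (g := Function.uncurry X) (f := fun p : ℝ × Ω => (t - p.1, p.2))
      ((measurable_fst.const_sub t).prodMk measurable_snd)) _)

/-- The uniform bound for the `k`-th moment of the occupation time of a ball. -/
def momentBound (d : ℕ) (R : ℝ) (k : ℕ) : ENNReal :=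
  ∏ i ∈ Finset.range k, ((i + 1 : ℕ) * ((i + 2 : ℕ) * ∫⁻ u, gapBound d R u))

lemma momentBound_ne_top (hd : 3 ≤ d) (R : ℝ) (k : ℕ) : momentBound d R k ≠ ⊤ :=
  ENNReal.prod_ne_top fun i _ => ENNReal.mul_ne_top (by simp)
    (ENNReal.mul_ne_top (by simp) (lintegral_gapBound_lt_top hd R).ne)

lemma lintegral_enorm_pow_le {Z : Ω → ℝ} (hXm : Measurable (Function.uncurry X))
    (hX : HasDensities P X (Set.Ioo 0 t) fun _ => bridgeDensity d t a b) (hK : K ≠ ⊤)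
    (hZ : ∀ ω, ‖Z ω‖ₑ ≤ K * ∫⁻ s in Set.Ioo 0 t, ballInd d R (X s ω)) (k : ℕ) :
    ∫⁻ ω, ‖Z ω ^ k‖ₑ ∂P ≤ K ^ k * momentBound d R k := by
  calc _ ≤ ∫⁻ ω, K ^ k * (∫⁻ s in Set.Ioo 0 t, ballInd d R (X s ω)) ^ k ∂P := by
        refine lintegral_mono fun ω => ?_
        simp only [enorm_pow, ← mul_pow]
        exact pow_le_pow_left' (hZ ω) k
    _ = K ^ k * ∫⁻ ω, (∫⁻ s in Set.Ioo 0 t, ballInd d R (X s ω)) ^ k ∂P :=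
        lintegral_const_mul' _ _ (ENNReal.pow_ne_top hK)
    _ ≤ _ := by
        gcongr
        exact lintegral_occupation_pow_le hXm hX k

/-- The error made when neglecting the times in the middle of the bridge. -/
lemma enorm_integral_pow_sub_two_sided_le (hd : 3 ≤ d) (hvm : Measurable v) (hK : K ≠ ⊤)
    (hv : ∀ z, ‖v z‖ₑ ≤ K * ballInd d R z) (hXm : Measurable (Function.uncurry X))
    (hX : HasDensities P X (Set.Ioo 0 t) fun _ => bridgeDensity d t a b)
    (hT : 0 ≤ T) (hTt : 2 * T ≤ t) (k : ℕ) {N : ℕ} (hN : N ≠ 0) :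
    ‖(∫ ω, (∫ s in Set.Ioo 0 t, v (X s ω)) ^ (k + 1) ∂P) -
        ∫ ω, ((∫ s in Set.Ioo 0 T, v (X s ω)) +
          ∫ s in Set.Ioo 0 T, v (X (t - s) ω)) ^ (k + 1) ∂P‖ₑ ≤
      ((k + 1 : ℕ) * K ^ (k + 1)) * (N * (2 * ∫⁻ u in Set.Ici T, gapBound d R u) +
        (N : ENNReal)⁻¹ * momentBound d R (2 * k + 1)) := by
  set Z : Ω → ℝ := fun ω => ∫ s in Set.Ioo 0 t, v (X s ω) with hZdef
  set Z' : Ω → ℝ := fun ω => (∫ s in Set.Ioo 0 T, v (X s ω)) +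
          ∫ s in Set.Ioo 0 T, v (X (t - s) ω) with hZ'def
  set V : Ω → ENNReal := fun ω => ∫⁻ s in Set.Ioo 0 t, ballInd d R (X s ω) with hV
  set D : Ω → ENNReal := fun ω => ∫⁻ s in Set.Ioo 0 t ∩ Set.Icc T (t - T), ballInd d R (X s ω)
    with hD
  have hXω : ∀ ω, Measurable fun s => X s ω := fun ω => hXm.of_uncurry_right
  have hZV : ∀ ω, ‖Z ω‖ₑ ≤ K * V ω := fun ω => enorm_setIntegral_le hK hv _ _
  have hZ'V : ∀ ω, ‖Z' ω‖ₑ ≤ K * V ω := fun ω =>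
    enorm_two_sided_integral_le hvm hK hv (hXω ω) hT hTt
  have hDV : ∀ ω, D ω ≤ V ω := fun ω => lintegral_mono_set Set.inter_subset_left
  have hm3 : Measurable fun p : Ω × ℝ => ballInd d R (X p.2 p.1) :=
    (measurable_ballInd d R).comp (hXm.comp measurable_swap)
  have hDm : Measurable D := hm3.lintegral_prod_right'
  have hintegrable : ∀ {Y : Ω → ℝ}, Measurable Y → (∀ ω, ‖Y ω‖ₑ ≤ K * V ω) →
      Integrable (fun ω => Y ω ^ (k + 1)) P := fun hY h =>
    ⟨(hY.pow_const _).aestronglyMeasurable, (lintegral_enorm_pow_le hXm hX hK h _).trans_lt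
      (ENNReal.mul_lt_top (ENNReal.pow_ne_top hK).lt_top (momentBound_ne_top hd R _).lt_top)⟩
  rw [← integral_sub (hintegrable (measurable_setIntegral_comp hvm hXm _) hZV)
    (hintegrable (measurable_two_sided_integral hvm hXm t T) hZ'V)]
  calc _ ≤ ∫⁻ ω, ‖Z ω ^ (k + 1) - Z' ω ^ (k + 1)‖ₑ ∂P := enorm_integral_le_lintegral_enorm _
    _ ≤ ∫⁻ ω, ((k + 1 : ℕ) * K ^ (k + 1)) * (N * D ω + (N : ENNReal)⁻¹ * V ω ^ (2 * k + 1)) ∂P := by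
        refine lintegral_mono fun ω => ?_
        refine (enorm_pow_succ_sub_pow_succ_le (hZV ω) (hZ'V ω) k).trans ?_
        rw [mul_assoc]
        refine mul_le_mul_right ?_ _
        calc _ ≤ K * D ω * (K * V ω) ^ k := by
              gcongr
              exact enorm_integral_sub_two_sided_le hvm hK hv (hXω ω) hT hTt
          _ = K ^ (k + 1) * (D ω * V ω ^ k) := by ring
          _ ≤ _ := by gcongr; exact mul_pow_le_add (hDV ω) k hN
    _ = ((k + 1 : ℕ) * K ^ (k + 1)) * (N * ∫⁻ ω, D ω ∂P +
          (N : ENNReal)⁻¹ * ∫⁻ ω, V ω ^ (2 * k + 1) ∂P) := by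
        rw [lintegral_const_mul' _ _ (ENNReal.mul_ne_top (by simp) (ENNReal.pow_ne_top hK)),
          lintegral_add_left (hDm.const_mul _), lintegral_const_mul' _ _ (by simp),
          lintegral_const_mul' _ _ (by simp [hN])]
    _ ≤ _ := by
        gcongr
        · exact lintegral_middle_occupation_le hXm hX
        · exact lintegral_occupation_pow_le hXm hX _

end Bridge

lemma tendsto_lintegral_Ici_gapBound {d : ℕ} (hd : 3 ≤ d) (R : ℝ) :
    Tendsto (fun n : ℕ => ∫⁻ u in Set.Ici (n : ℝ), gapBound d R u) atTop (𝓝 0) := by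
  have h := tendsto_measure_iInter_atTop (μ := (volume : Measure ℝ).withDensity (gapBound d R))
    (s := fun n : ℕ => Set.Ici (n : ℝ)) (fun n => measurableSet_Ici.nullMeasurableSet)
    (fun m n hmn => Set.Ici_subset_Ici.2 (by exact_mod_cast hmn))
    ⟨0, by
      rw [withDensity_apply _ measurableSet_Ici]
      exact ((lintegral_mono' Measure.restrict_le_self le_rfl).trans_lt
        (lintegral_gapBound_lt_top hd R)).ne⟩
  have e : ⋂ n : ℕ, Set.Ici (n : ℝ) = ∅ := by
    refine Set.eq_empty_of_forall_notMem fun u hu => ?_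
    obtain ⟨n, hn⟩ := exists_nat_gt u
    exact absurd (Set.mem_iInter.1 hu n) (not_le.2 hn)
  rw [e, measure_empty] at h
  refine h.congr fun n => ?_
  rw [Function.comp_apply, withDensity_apply _ measurableSet_Ici]

lemma tendsto_setLIntegral_Ioo_Ioi {f : ℝ → ENNReal} (hf : Measurable f) :
    Tendsto (fun n : ℕ => ∫⁻ s in Set.Ioo 0 (n : ℝ), f s) atTop
      (𝓝 (∫⁻ s in Set.Ioi 0, f s)) := by
  have h := (aecover_Iio (μ := (volume : Measure ℝ).restrict (Set.Ioi 0))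
    tendsto_natCast_atTop_atTop).lintegral_tendsto_of_countably_generated hf.aemeasurable
  refine h.congr fun n => ?_
  rw [Measure.restrict_restrict measurableSet_Iio, Set.inter_comm, Set.Ioi_inter_Iio]

lemma tendsto_setIntegral_Ioo_Ioi {f : ℝ → ℝ} (hf : IntegrableOn f (Set.Ioi 0)) :
    Tendsto (fun n : ℕ => ∫ s in Set.Ioo 0 (n : ℝ), f s) atTop (𝓝 (∫ s in Set.Ioi 0, f s)) := by
  have h := (aecover_Iio (μ := (volume : Measure ℝ).restrict (Set.Ioi 0))
    tendsto_natCast_atTop_atTop).integral_tendsto_of_countably_generated hf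
  refine h.congr fun n => ?_
  rw [Measure.restrict_restrict measurableSet_Iio, Set.inter_comm, Set.Ioi_inter_Iio]

lemma measurable_lintegral_ballInd {d : ℕ} {R : ℝ} {Ω : Type*} [MeasurableSpace Ω]
    {X : ℝ → Ω → Euc d} (hXm : Measurable (Function.uncurry X)) (S : Set ℝ) :
    Measurable fun ω => ∫⁻ s in S, ballInd d R (X s ω) :=
  have h : Measurable fun p : Ω × ℝ => ballInd d R (X p.2 p.1) :=
    (measurable_ballInd d R).comp (hXm.comp measurable_swap)
  h.lintegral_prod_right'

section Limit

variable {d : ℕ} {xf yf : ℝ → Euc d} {x y : Euc d} {Ω : Type*} [MeasurableSpace Ω] {P : Measure Ω}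
  [IsProbabilityMeasure P] {X : ℝ → ℝ → Ω → Euc d} {Ω' : Type*} [MeasurableSpace Ω']
  {P' : Measure Ω'} {W W' : ℝ → Ω' → Euc d}

lemma lintegral_truncated_occupation_pow_le [IsProbabilityMeasure P']
    (hx : Tendsto xf atTop (𝓝 x)) (hy : Tendsto yf atTop (𝓝 y))
    (hXm : ∀ t, Measurable (Function.uncurry (X t)))
    (hX : ∀ t, 0 < t → HasDensities P (X t) (Set.Ioo 0 t)
      fun _ => bridgeDensity d t (xf t) (yf t))
    (hWm : Measurable (Function.uncurry W)) (hWm' : Measurable (Function.uncurry W'))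
    (hW : HasDensities P' W (Set.Ioi 0) fun _ => jointDensity d x)
    (hW' : HasDensities P' W' (Set.Ioi 0) fun _ => jointDensity d y)
    (hind : IndepFun (fun ω s => W s ω) (fun ω s => W' s ω) P') (R : ℝ) (n k : ℕ) :
    ∫⁻ ω, ((∫⁻ s in Set.Ioo 0 (n : ℝ), ballInd d R (W s ω)) +
      ∫⁻ s in Set.Ioo 0 (n : ℝ), ballInd d R (W' s ω)) ^ k ∂P' ≤ momentBound d R k := by
  have hb1 : ∀ z, ballInd d R z < ⊤ := fun z => (ballInd_le_one d R z).trans_lt ENNReal.one_lt_top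
  have hum : Measurable fun z => (ballInd d R z).toReal := (measurable_ballInd d R).ennreal_toReal
  have hu : ∀ z, ‖(ballInd d R z).toReal‖ₑ ≤ 1 * ballInd d R z := fun z => by
    rw [Real.enorm_eq_ofReal ENNReal.toReal_nonneg, ENNReal.ofReal_toReal (hb1 z).ne, one_mul]
  have hlim := tendsto_integral_truncated_pow (v := fun z => (ballInd d R z).toReal) hum
    ⟨1, fun z => by
      rw [abs_of_nonneg ENNReal.toReal_nonneg]
      exact ENNReal.toReal_le_of_le_ofReal zero_le_one (by simpa using ballInd_le_one d R z)⟩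
    ⟨R, fun z hz => by
      by_contra! h
      refine hz ?_
      rw [ballInd, Set.indicator_of_notMem (by simpa using h)]
      rfl⟩ hx hy hXm hX hWm hWm' hW hW' hind n k
  have hle := le_of_tendsto (b := momentBound d R k) hlim.enorm (by
    filter_upwards [eventually_ge_atTop (2 * (n : ℝ)), eventually_gt_atTop 0] with t ht ht0
    refine (enorm_integral_le_lintegral_enorm _).trans ?_
    simpa using lintegral_enorm_pow_le (R := R) (hXm t) (hX t ht0) ENNReal.one_ne_top
      (fun ω => enorm_two_sided_integral_le hum ENNReal.one_ne_top hu
        (hXm t).of_uncurry_right n.cast_nonneg ht) k)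
  set U : Ω' → ENNReal := fun ω => (∫⁻ s in Set.Ioo 0 (n : ℝ), ballInd d R (W s ω)) +
      ∫⁻ s in Set.Ioo 0 (n : ℝ), ballInd d R (W' s ω) with hU
  have hUm : Measurable U :=
    (measurable_lintegral_ballInd hWm _).add (measurable_lintegral_ballInd hWm' _)
  have hbd : ∀ f : ℝ → Euc d, ∫⁻ s in Set.Ioo 0 (n : ℝ), ballInd d R (f s) ≤ n := fun f => by
    calc _ ≤ ∫⁻ s in Set.Ioo 0 (n : ℝ), 1 := lintegral_mono fun s => ballInd_le_one _ _ _
      _ = _ := by simp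
  have hreal : ∀ {f : ℝ → Euc d}, Measurable f →
      ∫ s in Set.Ioo 0 (n : ℝ), (ballInd d R (f s)).toReal =
        (∫⁻ s in Set.Ioo 0 (n : ℝ), ballInd d R (f s)).toReal := fun hf =>
    integral_toReal ((measurable_ballInd d R).comp hf).aemeasurable (ae_of_all _ fun s => hb1 _)
  have hUn : ∀ ω, U ω ≤ n + n := fun ω => add_le_add (hbd _) (hbd _)
  have hUtop : ∀ ω, U ω ^ k < ⊤ := fun ω =>
    ENNReal.pow_lt_top ((hUn ω).trans_lt (by finiteness))
  have hIntTop : ∫⁻ ω, U ω ^ k ∂P' ≠ ⊤ := by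
    refine ne_top_of_le_ne_top (b := ((n : ENNReal) + n) ^ k) (by finiteness) ?_
    calc _ ≤ ∫⁻ ω, ((n : ENNReal) + n) ^ k ∂P' :=
          lintegral_mono fun ω => pow_le_pow_left' (hUn ω) k
      _ = _ := by simp
  have e : ∀ ω, ((∫ s in Set.Ioo 0 (n : ℝ), (ballInd d R (W s ω)).toReal) +
      ∫ s in Set.Ioo 0 (n : ℝ), (ballInd d R (W' s ω)).toReal) ^ k = (U ω ^ k).toReal := by
    intro ω
    rw [hreal hWm.of_uncurry_right, hreal hWm'.of_uncurry_right, ENNReal.toReal_pow, hU,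
      ENNReal.toReal_add ((hbd _).trans_lt (by finiteness)).ne
        ((hbd _).trans_lt (by finiteness)).ne]
  simp only [e] at hle
  rwa [integral_toReal (hUm.pow_const k).aemeasurable (ae_of_all _ hUtop),
    Real.enorm_eq_ofReal ENNReal.toReal_nonneg, ENNReal.ofReal_toReal hIntTop] at hle

lemma lintegral_total_occupation_pow_le
    (hWm : Measurable (Function.uncurry W)) (hWm' : Measurable (Function.uncurry W')) {R : ℝ}
    {k : ℕ} {M : ENNReal} (h : ∀ n : ℕ, ∫⁻ ω, ((∫⁻ s in Set.Ioo 0 (n : ℝ), ballInd d R (W s ω)) +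
      ∫⁻ s in Set.Ioo 0 (n : ℝ), ballInd d R (W' s ω)) ^ k ∂P' ≤ M) :
    ∫⁻ ω, ((∫⁻ s in Set.Ioi 0, ballInd d R (W s ω)) +
      ∫⁻ s in Set.Ioi 0, ballInd d R (W' s ω)) ^ k ∂P' ≤ M := by
  have hsub : ∀ {m n : ℕ}, m ≤ n → Set.Ioo 0 (m : ℝ) ⊆ Set.Ioo 0 (n : ℝ) := fun hmn =>
    Set.Ioo_subset_Ioo_right (by exact_mod_cast hmn)
  refine le_of_tendsto' (lintegral_tendsto_of_tendsto_of_monotone (fun n => ?_)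
    (ae_of_all _ fun ω m n hmn => ?_) (ae_of_all _ fun ω => ?_)) h
  · exact (((measurable_lintegral_ballInd hWm _).add
      (measurable_lintegral_ballInd hWm' _)).pow_const k).aemeasurable
  · exact pow_le_pow_left' (add_le_add (lintegral_mono_set (hsub hmn))
      (lintegral_mono_set (hsub hmn))) k
  · exact ((ENNReal.continuous_pow k).tendsto _).comp ((tendsto_setLIntegral_Ioo_Ioi
      ((measurable_ballInd d R).comp hWm.of_uncurry_right)).add (tendsto_setLIntegral_Ioo_Ioi
      ((measurable_ballInd d R).comp hWm'.of_uncurry_right)))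

lemma tendsto_integral_total_pow {v : Euc d → ℝ} {K : ENNReal} {R : ℝ} (hvm : Measurable v)
    (hK : K ≠ ⊤) (hv : ∀ z, ‖v z‖ₑ ≤ K * ballInd d R z)
    (hWm : Measurable (Function.uncurry W)) (hWm' : Measurable (Function.uncurry W'))
    (h : ∀ k : ℕ, ∫⁻ ω, ((∫⁻ s in Set.Ioi 0, ballInd d R (W s ω)) +
      ∫⁻ s in Set.Ioi 0, ballInd d R (W' s ω)) ^ k ∂P' ≠ ⊤) (k : ℕ) :
    Tendsto (fun n : ℕ => ∫ ω, ((∫ s in Set.Ioo 0 (n : ℝ), v (W s ω)) +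
        ∫ s in Set.Ioo 0 (n : ℝ), v (W' s ω)) ^ k ∂P') atTop
      (𝓝 (∫ ω, ((∫ s in Set.Ioi 0, v (W s ω)) + ∫ s in Set.Ioi 0, v (W' s ω)) ^ k ∂P')) := by
  set U : Ω' → ENNReal := fun ω => (∫⁻ s in Set.Ioi 0, ballInd d R (W s ω)) +
      ∫⁻ s in Set.Ioi 0, ballInd d R (W' s ω) with hU
  have hUm : Measurable U :=
    (measurable_lintegral_ballInd hWm _).add (measurable_lintegral_ballInd hWm' _)
  have hUfin : ∀ᵐ ω ∂P', U ω < ⊤ := ae_lt_top hUm (by simpa using h 1)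
  refine tendsto_integral_of_dominated_convergence (fun ω => ((K * U ω) ^ k).toReal)
    (fun n => ?_) ?_ (fun n => ?_) ?_
  · exact (((measurable_setIntegral_comp hvm hWm _).add
      (measurable_setIntegral_comp hvm hWm' _)).pow_const k).aestronglyMeasurable
  · refine integrable_toReal_of_lintegral_ne_top
      ((hUm.const_mul K).pow_const k).aemeasurable ?_
    simp only [mul_pow]
    rw [lintegral_const_mul' _ _ (ENNReal.pow_ne_top hK)]
    exact ENNReal.mul_ne_top (ENNReal.pow_ne_top hK) (h k)
  · filter_upwards [hUfin] with ω hω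
    rw [← toReal_enorm]
    refine ENNReal.toReal_mono (ENNReal.pow_ne_top (ENNReal.mul_ne_top hK hω.ne)) ?_
    rw [enorm_pow]
    refine pow_le_pow_left' ?_ k
    rw [hU, mul_add]
    refine (enorm_add_le _ _).trans (add_le_add ?_ ?_) <;>
    · refine (enorm_setIntegral_le hK hv _ _).trans ?_
      gcongr
      exact Set.Ioo_subset_Ioi_self
  · filter_upwards [hUfin] with ω hω
    have h1 := ENNReal.add_lt_top.1 hω
    exact ((tendsto_setIntegral_Ioo_Ioi (integrableOn_comp_path hvm hK hv hWm.of_uncurry_right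
      h1.1.ne)).add (tendsto_setIntegral_Ioo_Ioi (integrableOn_comp_path hvm hK hv
      hWm'.of_uncurry_right h1.2.ne))).pow k

/-- Convergence of the moments for jointly measurable processes. -/
theorem tendsto_integral_pow_of_measurable [IsProbabilityMeasure P'] (hd : 3 ≤ d) {v : Euc d → ℝ} (hvm : Measurable v)
    (hvb : ∃ C : ℝ, ∀ z, |v z| ≤ C) (hvs : ∃ R : ℝ, ∀ z, v z ≠ 0 → ‖z‖ ≤ R)
    (hx : Tendsto xf atTop (𝓝 x)) (hy : Tendsto yf atTop (𝓝 y))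
    (hXm : ∀ t, Measurable (Function.uncurry (X t)))
    (hX : ∀ t, 0 < t → HasDensities P (X t) (Set.Ioo 0 t)
      fun _ => bridgeDensity d t (xf t) (yf t))
    (hWm : Measurable (Function.uncurry W)) (hWm' : Measurable (Function.uncurry W'))
    (hW : HasDensities P' W (Set.Ioi 0) fun _ => jointDensity d x)
    (hW' : HasDensities P' W' (Set.Ioi 0) fun _ => jointDensity d y)
    (hind : IndepFun (fun ω s => W s ω) (fun ω s => W' s ω) P') (k : ℕ) :
    Tendsto (fun t => ∫ ω, (∫ s in Set.Ioo 0 t, v (X t s ω)) ^ k ∂P) atTop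
      (𝓝 (∫ ω, ((∫ s in Set.Ioi 0, v (W s ω)) + ∫ s in Set.Ioi 0, v (W' s ω)) ^ k ∂P')) := by
  cases k with
  | zero => simp
  | succ k =>
  obtain ⟨C, hC⟩ := hvb
  obtain ⟨R, hR⟩ := hvs
  obtain ⟨K, hK, hv⟩ : ∃ K : ENNReal, K ≠ ⊤ ∧ ∀ z, ‖v z‖ₑ ≤ K * ballInd d R z := by
    refine ⟨ENNReal.ofReal C, ENNReal.ofReal_ne_top, fun z => ?_⟩
    by_cases hz : v z = 0
    · simp [hz]
    · rw [ballInd, Set.indicator_of_mem (by simpa using hR z hz), Pi.one_apply, mul_one,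
        ← ofReal_norm]
      exact ENNReal.ofReal_le_ofReal (hC z)
  have hmom := fun k => lintegral_total_occupation_pow_le hWm hWm' fun n =>
    lintegral_truncated_occupation_pow_le hx hy hXm hX hWm hWm' hW hW' hind R n k
  have hlim2 := tendsto_integral_total_pow hvm hK hv hWm hWm'
    (fun k => ne_top_of_le_ne_top (momentBound_ne_top hd R k) (hmom k)) (k + 1)
  rw [Metric.tendsto_nhds]
  intro ε hε
  have hε3 : 0 < ε / 3 := by positivity
  obtain ⟨n, hn1, hn2⟩ : ∃ n : ℕ, (∀ t, 0 < t → 2 * (n : ℝ) ≤ t →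
      dist (∫ ω, (∫ s in Set.Ioo 0 t, v (X t s ω)) ^ (k + 1) ∂P)
        (∫ ω, ((∫ s in Set.Ioo 0 (n : ℝ), v (X t s ω)) +
          ∫ s in Set.Ioo 0 (n : ℝ), v (X t (t - s) ω)) ^ (k + 1) ∂P) < ε / 3) ∧
      dist (∫ ω, ((∫ s in Set.Ioo 0 (n : ℝ), v (W s ω)) +
        ∫ s in Set.Ioo 0 (n : ℝ), v (W' s ω)) ^ (k + 1) ∂P')
        (∫ ω, ((∫ s in Set.Ioi 0, v (W s ω)) + ∫ s in Set.Ioi 0, v (W' s ω)) ^ (k + 1) ∂P') <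
        ε / 3 := by
    have hc : ((k + 1 : ℕ) : ENNReal) * K ^ (k + 1) ≠ ⊤ :=
      ENNReal.mul_ne_top (by simp) (ENNReal.pow_ne_top hK)
    have hM := momentBound_ne_top hd R (2 * k + 1)
    have hN : Tendsto (fun N : ℕ => ((k + 1 : ℕ) * K ^ (k + 1)) *
        ((N : ENNReal)⁻¹ * momentBound d R (2 * k + 1))) atTop (𝓝 0) := by
      have := ENNReal.Tendsto.const_mul (ENNReal.Tendsto.mul_const
        ENNReal.tendsto_inv_nat_nhds_zero (Or.inr hM)) (Or.inr hc)
      simpa using this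
    obtain ⟨N, hN0, hN1⟩ := ((eventually_ne_atTop 0).and
      (hN.eventually (gt_mem_nhds (ENNReal.ofReal_pos.2 hε3)))).exists
    have hτ : Tendsto (fun n : ℕ => ((k + 1 : ℕ) * K ^ (k + 1)) *
        (N * (2 * ∫⁻ u in Set.Ici (n : ℝ), gapBound d R u) +
        (N : ENNReal)⁻¹ * momentBound d R (2 * k + 1))) atTop
        (𝓝 (((k + 1 : ℕ) * K ^ (k + 1)) * ((N : ENNReal)⁻¹ * momentBound d R (2 * k + 1)))) := by
      have := ENNReal.Tendsto.const_mul ((ENNReal.Tendsto.const_mul (ENNReal.Tendsto.const_mul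
        (tendsto_lintegral_Ici_gapBound hd R) (Or.inr (by simp : (2 : ENNReal) ≠ ⊤)))
        (Or.inr (by simp : (N : ENNReal) ≠ ⊤))).add_const
        ((N : ENNReal)⁻¹ * momentBound d R (2 * k + 1))) (Or.inr hc)
      simpa using this
    obtain ⟨n, hn1, hn2⟩ := ((hτ.eventually (gt_mem_nhds hN1)).and
      (hlim2.eventually (Metric.ball_mem_nhds _ hε3))).exists
    refine ⟨n, fun t ht0 ht => ?_, hn2⟩
    have h := (enorm_integral_pow_sub_two_sided_le hd hvm hK hv (hXm t) (hX t ht0)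
      n.cast_nonneg ht k hN0).trans_lt hn1
    rw [dist_eq_norm]
    rwa [← ofReal_norm, ENNReal.ofReal_lt_ofReal_iff hε3] at h
  have hlim1 := tendsto_integral_truncated_pow hvm ⟨C, hC⟩ ⟨R, hR⟩ hx hy hXm hX hWm hWm' hW hW'
    hind n (k + 1)
  filter_upwards [eventually_gt_atTop 0, eventually_ge_atTop (2 * (n : ℝ)),
    Metric.tendsto_nhds.1 hlim1 _ hε3] with t ht0 ht h3
  have h4 := add_lt_add (add_lt_add (hn1 t ht0 ht) h3) hn2
  rw [add_thirds] at h4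
  exact (dist_triangle4 _ _ _ _).trans_lt h4

end Limit

lemma HasDensities.congr {Ω : Type*} [MeasurableSpace Ω] {d : ℕ} {P : Measure Ω}
    {X Y : ℝ → Ω → Euc d} {A : Set ℝ} {p : ∀ k : ℕ, (Fin k → ℝ) → (Fin k → Euc d) → ℝ}
    (h : HasDensities P X A p) (hXY : ∀ᵐ ω ∂P, ∀ s ∈ A, Y s ω = X s ω) : HasDensities P Y A p := by
  intro k s hs hsA
  rw [← h k s hs hsA]
  refine Measure.map_congr ?_
  filter_upwards [hXY] with ω hω
  exact funext fun i => hω _ (hsA i)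

lemma HasDensities.aemeasurable {Ω : Type*} [MeasurableSpace Ω] {d : ℕ} {P : Measure Ω}
    {X : ℝ → Ω → Euc d} {A : Set ℝ} {p : ∀ k : ℕ, (Fin k → ℝ) → (Fin k → Euc d) → ℝ}
    (h : HasDensities P X A p) {s : ℝ} (hs : s ∈ A) (hpm : Measurable (p 1 fun _ => s))
    (hp : ∀ z, 0 < p 1 (fun _ => s) z) : AEMeasurable (X s) P := by
  by_contra hX
  have hX' : ¬ AEMeasurable (fun ω (_ : Fin 1) => X s ω) P := fun h' =>
    hX ((measurable_pi_apply 0).comp_aemeasurable h')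
  have h1 := h 1 (fun _ => s) (Subsingleton.strictMono _) fun _ => hs
  rw [Measure.map_of_not_aemeasurable hX', eq_comm,
    withDensity_eq_zero_iff hpm.ennreal_ofReal.aemeasurable] at h1
  obtain ⟨z, hz⟩ := h1.exists
  exact (ENNReal.ofReal_pos.2 (hp z)).ne' hz

/-- A continuous process all of whose marginals are almost everywhere measurable agrees almost
surely with a jointly measurable process. -/
lemma exists_measurable_uncurry_ae_eq {Ω : Type*} [MeasurableSpace Ω] {d : ℕ} {P : Measure Ω}
    {Y : ℝ → Ω → Euc d} (hc : ∀ ω, Continuous fun s => Y s ω) (hm : ∀ s, AEMeasurable (Y s) P) :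
    ∃ Z : ℝ → Ω → Euc d, Measurable (Function.uncurry Z) ∧ ∀ᵐ ω ∂P, ∀ s, Z s ω = Y s ω := by
  have hae : ∀ᵐ ω ∂P, ∀ q : ℚ, Y q ω = (hm q).mk _ ω := ae_all_iff.2 fun q => (hm q).ae_eq_mk
  set N : Set Ω := {ω | ∀ q : ℚ, Y q ω = (hm q).mk _ ω} with hN
  set S : Set Ω := (toMeasurable P Nᶜ)ᶜ with hS
  have hSm : MeasurableSet S := (measurableSet_toMeasurable P Nᶜ).compl
  have hSN : S ⊆ N := Set.compl_subset_comm.1 (subset_toMeasurable P Nᶜ)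
  have hSae : ∀ᵐ ω ∂P, ω ∈ S := by
    rw [ae_iff]
    have : {ω | ω ∉ S} = toMeasurable P Nᶜ := by ext ω; simp [hS]
    rw [this, measure_toMeasurable]
    exact hae
  refine ⟨fun s => S.indicator (Y s), ?_, ?_⟩
  · have hcont : ∀ ω, Continuous fun s => S.indicator (Y s) ω := by
      intro ω
      by_cases h : ω ∈ S
      · simpa [h] using hc ω
      · simpa [h] using continuous_const
    refine measurable_uncurry_of_continuous_of_measurable hcont fun s => ?_
    have hq : ∀ q : ℚ, Measurable (S.indicator (Y q)) := by
      intro q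
      have : S.indicator (Y q) = S.indicator ((hm q).mk _) :=
        Set.indicator_congr fun ω hω => hSN hω q
      rw [this]
      exact (hm q).measurable_mk.indicator hSm
    obtain ⟨u, hu, hus⟩ := mem_closure_iff_seq_limit.1 (Rat.denseRange_cast (𝕜 := ℝ) s)
    choose q hq' using hu
    refine measurable_of_tendsto_metrizable (f := fun n => S.indicator (Y (u n))) (fun n => ?_) ?_
    · simp only [← hq']
      exact hq _
    · exact tendsto_pi_nhds.2 fun ω => ((hcont ω).tendsto s).comp hus
  · filter_upwards [hSae] with ω hω s
    simp [hω]

lemma bridgeDensity_pos {d k : ℕ} {t : ℝ} (ht : 0 < t) (a b : Euc d) {s : Fin k → ℝ}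
    (hs : StrictMono s) (hst : ∀ i, s i ∈ Set.Ioo 0 t) (z : Fin k → Euc d) :
    0 < bridgeDensity d t a b s z :=
  div_pos (jointDensity_pos (strictMono_snoc hs fun i => (hst i).2)
    (snoc_pos (fun i => (hst i).1) ht) _ _) (heatKernel_pos ht _)

lemma bridgeDensity_zero {d : ℕ} {t : ℝ} (ht : 0 < t) (a b : Euc d) (s : Fin 0 → ℝ)
    (z : Fin 0 → Euc d) : bridgeDensity d t a b s z = 1 := by
  rw [bridgeDensity, jointDensity_snoc, jointDensity_zero, one_mul]
  simpa using div_self (heatKernel_pos ht (b - a)).ne'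

lemma IsBrownianBridge.exists_measurable {Ω : Type*} [MeasureSpace Ω]
    [IsProbabilityMeasure (ℙ : Measure Ω)] {d : ℕ} {t : ℝ} (ht : 0 < t) {a b : Euc d}
    {X : ℝ → Ω → Euc d} (hX : IsBrownianBridge t a b X) :
    ∃ Z : ℝ → Ω → Euc d, Measurable (Function.uncurry Z) ∧
      HasDensities ℙ Z (Set.Ioo 0 t) (fun _ => bridgeDensity d t a b) ∧
      ∀ᵐ ω, ∀ s ∈ Set.Ioo 0 t, Z s ω = X s ω := by
  obtain ⟨h0, h1, hc, hfd⟩ := hX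
  have hD : HasDensities ℙ X (Set.Ioo 0 t) fun _ => bridgeDensity d t a b :=
    HasDensities.of_succ (fun s z => bridgeDensity_zero ht a b s z) hfd
  obtain ⟨Z, hZm, hZ⟩ := exists_measurable_uncurry_ae_eq (P := (ℙ : Measure Ω))
    (Y := fun s => X (max 0 (min s t)))
    (fun ω => (hc ω).comp_continuous (f := fun s => max 0 (min s t)) (by fun_prop)
      fun s => ⟨le_max_left _ _, max_le ht.le (min_le_right _ _)⟩) (fun s => by
    rcases le_or_gt s 0 with hs | hs
    · rw [min_eq_left (hs.trans ht.le), max_eq_left hs, funext h0]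
      exact aemeasurable_const
    rcases le_or_gt t s with hst | hst
    · rw [min_eq_right hst, max_eq_right ht.le, funext h1]
      exact aemeasurable_const
    · rw [min_eq_left hst.le, max_eq_right hs.le]
      exact hD.aemeasurable ⟨hs, hst⟩ (continuous_bridgeDensity d t _ _ _).measurable
        (bridgeDensity_pos ht a b (Subsingleton.strictMono _) fun _ => ⟨hs, hst⟩))
  have hZX : ∀ᵐ ω, ∀ s ∈ Set.Ioo 0 t, Z s ω = X s ω := by
    filter_upwards [hZ] with ω hω s hs
    rw [hω s, min_eq_left hs.2.le, max_eq_right hs.1.le]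
  exact ⟨Z, hZm, hD.congr hZX, hZX⟩

lemma IsBrownianMotion.exists_measurable {Ω : Type*} [MeasureSpace Ω]
    [IsProbabilityMeasure (ℙ : Measure Ω)] {d : ℕ} {x : Euc d} {W : ℝ → Ω → Euc d}
    (hW : IsBrownianMotion x W) :
    ∃ Z : ℝ → Ω → Euc d, Measurable (Function.uncurry Z) ∧
      HasDensities ℙ Z (Set.Ioi 0) (fun _ => jointDensity d x) ∧
      ∀ᵐ ω, ∀ s, Z s ω = W (max 0 s) ω := by
  obtain ⟨h0, hc, hfd⟩ := hW
  have hD : HasDensities ℙ W (Set.Ioi 0) fun _ => jointDensity d x :=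
    HasDensities.of_succ (fun s z => jointDensity_zero _ _ _) hfd
  obtain ⟨Z, hZm, hZ⟩ := exists_measurable_uncurry_ae_eq (P := (ℙ : Measure Ω))
    (Y := fun s => W (max 0 s)) (fun ω => (hc ω).comp (by fun_prop)) (fun s => by
    rcases le_or_gt s 0 with hs | hs
    · rw [max_eq_left hs, funext h0]
      exact aemeasurable_const
    · rw [max_eq_right hs.le]
      exact hD.aemeasurable hs (measurable_jointDensity _ _ _)
        (jointDensity_pos (Subsingleton.strictMono _) (fun _ => hs) x))
  refine ⟨Z, hZm, hD.congr ?_, hZ⟩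
  filter_upwards [hZ] with ω hω s hs
  rw [hω s, max_eq_right (Set.mem_Ioi.1 hs).le]

lemma integral_congr_pathIntInf {Ω : Type*} {d : ℕ} {v : Euc d → ℝ} {Z W : ℝ → Ω → Euc d} {ω : Ω}
    (h : ∀ s, Z s ω = W (max 0 s) ω) : pathIntInf v W ω = ∫ s in Set.Ioi 0, v (Z s ω) := by
  refine setIntegral_congr_fun measurableSet_Ioi fun s hs => ?_
  simp only [h s, max_eq_right (Set.mem_Ioi.1 hs).le]

/-- Theorem 1 (moments): the moments of the bridge path integral converge to those of the
sum of two independent total Brownian path integrals. -/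
theorem stmt13 (d : ℕ) (hd : 3 ≤ d) (v : Euc d → ℝ)
    (hvm : Measurable v) (hvb : ∃ C : ℝ, ∀ z, |v z| ≤ C)
    (hvs : ∃ R : ℝ, ∀ z, v z ≠ 0 → ‖z‖ ≤ R)
    (xf yf : ℝ → Euc d) (x y : Euc d)
    (hx : Tendsto xf atTop (𝓝 x)) (hy : Tendsto yf atTop (𝓝 y))
    {Ω : Type*} [MeasureSpace Ω] [IsProbabilityMeasure (ℙ : Measure Ω)]
    (X : ℝ → ℝ → Ω → Euc d) (hX : ∀ t : ℝ, 0 < t → IsBrownianBridge t (xf t) (yf t) (X t))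
    {Ω' : Type*} [MeasureSpace Ω'] [IsProbabilityMeasure (ℙ : Measure Ω')]
    (W W' : ℝ → Ω' → Euc d)
    (hWx : IsBrownianMotion x W) (hWy : IsBrownianMotion y W')
    (hindep : IndepFun (fun ω (s : ℝ) => W s ω) (fun ω (s : ℝ) => W' s ω) ℙ) :
    ∀ k : ℕ, Tendsto (fun t : ℝ => ∫ ω, (pathInt v (X t) t ω) ^ k) atTop
      (𝓝 (∫ ω', (pathIntInf v W ω' + pathIntInf v W' ω') ^ k)) := by
  intro k
  have hXex : ∀ t : ℝ, ∃ Z : ℝ → Ω → Euc d, Measurable (Function.uncurry Z) ∧ (0 < t →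
      HasDensities ℙ Z (Set.Ioo 0 t) (fun _ => bridgeDensity d t (xf t) (yf t)) ∧
      ∀ᵐ ω, ∀ s ∈ Set.Ioo 0 t, Z s ω = X t s ω) := by
    intro t
    by_cases ht : 0 < t
    · obtain ⟨Z, h1, h2⟩ := (hX t ht).exists_measurable ht
      exact ⟨Z, h1, fun _ => h2⟩
    · exact ⟨fun _ _ => 0, measurable_const, fun h => absurd h ht⟩
  choose Z hZm hZ using hXex
  obtain ⟨U, hUm, hUD, hU⟩ := hWx.exists_measurable
  obtain ⟨U', hUm', hUD', hU'⟩ := hWy.exists_measurable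
  have hg : Measurable fun (g : ℝ → Euc d) (s : ℝ) => g (max 0 s) :=
    measurable_pi_lambda _ fun s => measurable_pi_apply _
  have hind : IndepFun (fun ω s => U s ω) (fun ω s => U' s ω) ℙ := by
    refine (hindep.comp hg hg).congr ?_ ?_
    · filter_upwards [hU] with ω hω
      exact funext fun s => (hω s).symm
    · filter_upwards [hU'] with ω hω
      exact funext fun s => (hω s).symm
  have h := tendsto_integral_pow_of_measurable hd hvm hvb hvs hx hy hZm (fun t ht => (hZ t ht).1)
    hUm hUm' hUD hUD' hind k
  have e : ∫ ω', (pathIntInf v W ω' + pathIntInf v W' ω') ^ k =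
      ∫ ω, ((∫ s in Set.Ioi 0, v (U s ω)) + ∫ s in Set.Ioi 0, v (U' s ω)) ^ k := by
    refine integral_congr_ae ?_
    filter_upwards [hU, hU'] with ω hω hω'
    rw [integral_congr_pathIntInf hω, integral_congr_pathIntInf hω']
  rw [e]
  refine h.congr' ?_
  filter_upwards [eventually_gt_atTop 0] with t ht
  refine integral_congr_ae ?_
  filter_upwards [(hZ t ht).2] with ω hω
  rw [pathInt, integral_Ioc_eq_integral_Ioo]
  congr 1
  exact setIntegral_congr_fun measurableSet_Ioo fun s hs => by simp only [hω s hs]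

end
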